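/- Let 1 < p < ∞, N ≥ 2 and 0 < r0 < r1. For every c ∈ ℝ^N with 0 < |c| < r1 − r0, the first Dirichlet eigenvalue of the p-Laplacian satisfies λ1(B(0,r1) \ closure(B(c,r0))) < λ1(B(0,r1) \ closure(B(0,r0))). In other words, among all placements of a ball of radius r0 whose closure lies inside B(0,r1), the first Dirichlet eigenvalue of the resulting annular region attains its maximum exactly in the concentric configuration. -/

import Mathlib

open MeasureTheory RealInnerProductSpace Metric Set

noncomputable section

/-- Smooth test functions compactly supported in `U` (the class `C_c^∞(U)`). -/
def IsTestFun {N : ℕ} (U : Set (EuclideanSpace ℝ (Fin N)))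
    (φ : EuclideanSpace ℝ (Fin N) → ℝ) : Prop :=
  ContDiff ℝ (⊤ : ℕ∞) φ ∧ HasCompactSupport φ ∧ tsupport φ ⊆ U

/-- `u` is a weak solution of `-Δ_p u = h` in `U`:
`∫_U |∇u|^{p-2} ⟨∇u, ∇φ⟩ = ∫_U h φ` for all test functions `φ`. -/
def IsWeakSolution (p : ℝ) {N : ℕ} (U : Set (EuclideanSpace ℝ (Fin N)))
    (u h : EuclideanSpace ℝ (Fin N) → ℝ) : Prop :=
  ∀ φ : EuclideanSpace ℝ (Fin N) → ℝ, IsTestFun U φ →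
    (∫ x in U, ‖gradient u x‖ ^ (p - 2) * ⟪gradient u x, gradient φ x⟫)
      = ∫ x in U, h x * φ x

/-- The `p`-torsional rigidity of `U`:
`E(U) = (p/(p-1)) ⬝ sup { ∫_U φ - (1/p) ∫_U |∇φ|^p : φ ∈ C_c^∞(U) }`. -/
def pTorsionalRigidity (p : ℝ) {N : ℕ} (U : Set (EuclideanSpace ℝ (Fin N))) : ℝ :=
  (p / (p - 1)) *
    sSup { r : ℝ | ∃ φ, IsTestFun U φ ∧
      r = (∫ x in U, φ x) - (1 / p) * ∫ x in U, ‖gradient φ x‖ ^ p }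

/-- The first Dirichlet eigenvalue of the `p`-Laplacian on `U`:
`λ₁(U) = inf { (∫_U |∇φ|^p)/(∫_U |φ|^p) : φ ∈ C_c^∞(U), φ ≢ 0 }`. -/
def pLambda1 (p : ℝ) {N : ℕ} (U : Set (EuclideanSpace ℝ (Fin N))) : ℝ :=
  sInf { r : ℝ | ∃ φ, IsTestFun U φ ∧ φ ≠ 0 ∧
    r = (∫ x in U, ‖gradient φ x‖ ^ p) / (∫ x in U, |φ x| ^ p) }

/-- `f` is `C^1` on the closure of `U` (i.e. `C^1` on an open neighbourhood of it). -/
def C1OnClosure {N : ℕ} (U : Set (EuclideanSpace ℝ (Fin N)))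
    (f : EuclideanSpace ℝ (Fin N) → ℝ) : Prop :=
  ∃ W, IsOpen W ∧ closure U ⊆ W ∧ ContDiffOn ℝ 1 f W

/-- `Ω` has a smooth boundary: it is the sublevel set of a smooth function whose
differential does not vanish on the boundary. -/
def HasSmoothBoundary {N : ℕ} (Ω : Set (EuclideanSpace ℝ (Fin N))) : Prop :=
  ∃ f : EuclideanSpace ℝ (Fin N) → ℝ, ContDiff ℝ (⊤ : ℕ∞) f ∧ Ω = f ⁻¹' Set.Iio 0 ∧
    ∀ x ∈ frontier Ω, fderiv ℝ f x ≠ 0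

/-- The index of the first coordinate. -/
def firstIdx (N : ℕ) (hN : 2 ≤ N) : Fin N := ⟨0, by omega⟩

/-- The first standard basis vector `e₁`. -/
def e1v {N : ℕ} (hN : 2 ≤ N) : EuclideanSpace ℝ (Fin N) :=
  EuclideanSpace.single (firstIdx N hN) 1

/-- The domain `Ω(s) = B(0,r1) \ closure B(s e₁, r0)`. -/
def annulus {N : ℕ} (hN : 2 ≤ N) (r0 r1 s : ℝ) : Set (EuclideanSpace ℝ (Fin N)) :=
  Metric.ball (0 : EuclideanSpace ℝ (Fin N)) r1 \ closure (Metric.ball (s • e1v hN) r0)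

/-- Reflection across the hyperplane `{x₁ = s}`: `x ↦ (2s - x₁, x₂, …, x_N)`. -/
def reflectH {N : ℕ} (hN : 2 ≤ N) (s : ℝ) (x : EuclideanSpace ℝ (Fin N)) :
    EuclideanSpace ℝ (Fin N) :=
  x + (2 * (s - x (firstIdx N hN))) • e1v hN

/-- The divergence of a vector field, as the trace of its Jacobian. -/
def divergence {N : ℕ} (V : EuclideanSpace ℝ (Fin N) → EuclideanSpace ℝ (Fin N))
    (x : EuclideanSpace ℝ (Fin N)) : ℝ :=
  LinearMap.trace ℝ _ (fderiv ℝ V x : EuclideanSpace ℝ (Fin N) →ₗ[ℝ] EuclideanSpace ℝ (Fin N))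

/-- The classical `p`-Laplacian `Δ_p b = div(|∇b|^{p-2} ∇b)` at a point. -/
def pLapAt (p : ℝ) {N : ℕ} (b : EuclideanSpace ℝ (Fin N) → ℝ)
    (x : EuclideanSpace ℝ (Fin N)) : ℝ :=
  divergence (fun z => ‖gradient b z‖ ^ (p - 2) • gradient b z) x

/-- The torsion function of `U`: `C^1` up to the boundary, vanishing on the boundary,
positive inside, weak solution of `-Δ_p y = 1`. -/
def IsTorsionFn (p : ℝ) {N : ℕ} (U : Set (EuclideanSpace ℝ (Fin N)))
    (y : EuclideanSpace ℝ (Fin N) → ℝ) : Prop :=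
  C1OnClosure U y ∧ (∀ x ∈ frontier U, y x = 0) ∧ (∀ x ∈ U, 0 < y x) ∧
    IsWeakSolution p U y (fun _ => 1)

/-- A first eigenfunction of the Dirichlet `p`-Laplacian on `U`: `C^1` up to the boundary,
positive inside, vanishing on the boundary, `L^p`-normalized, weak solution of
`-Δ_p u = λ₁(U) u^{p-1}`. -/
def IsFirstEigenfun (p : ℝ) {N : ℕ} (U : Set (EuclideanSpace ℝ (Fin N)))
    (y : EuclideanSpace ℝ (Fin N) → ℝ) : Prop :=
  C1OnClosure U y ∧ (∀ x ∈ U, 0 < y x) ∧ (∀ x ∈ frontier U, y x = 0) ∧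
    (∫ x in U, y x ^ p) = 1 ∧
    IsWeakSolution p U y (fun x => pLambda1 p U * y x ^ (p - 1))

/-- The matrix `DA(x) = |x|^{p-2} I + (p-2)|x|^{p-4} x xᵀ`,
the derivative of `A(x) = |x|^{p-2} x`. -/
def DA (p : ℝ) {N : ℕ} (x : EuclideanSpace ℝ (Fin N)) :
    EuclideanSpace ℝ (Fin N) →L[ℝ] EuclideanSpace ℝ (Fin N) :=
  ‖x‖ ^ (p - 2) • ContinuousLinearMap.id ℝ (EuclideanSpace ℝ (Fin N)) +
    ((p - 2) * ‖x‖ ^ (p - 4)) • (innerSL ℝ x).smulRight x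

/-- `w` is a nonnegative bounded weak solution, continuous on the closure of `Ω` and `C^1`
inside, of `-Δ_p w = F(x, w)` in `Ω` with boundary value `bdry` on `∂Ω`. -/
def SolClass (p : ℝ) {N : ℕ} (Ω : Set (EuclideanSpace ℝ (Fin N)))
    (F : EuclideanSpace ℝ (Fin N) → ℝ → ℝ)
    (bdry w : EuclideanSpace ℝ (Fin N) → ℝ) : Prop :=
  ContinuousOn w (closure Ω) ∧ ContDiffOn ℝ 1 w Ω ∧
    (∀ x ∈ closure Ω, 0 ≤ w x) ∧ (∃ M, ∀ x ∈ closure Ω, |w x| ≤ M) ∧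
    IsWeakSolution p Ω w (fun x => F x (w x)) ∧ (∀ x ∈ frontier Ω, w x = bdry x)

theorem fderiv_eq_of_eventually_le_of_eq {E : Type*} [NormedAddCommGroup E] [NormedSpace ℝ E]
    {u v : E → ℝ} {x : E} (hu : DifferentiableAt ℝ u x) (hv : DifferentiableAt ℝ v x)
    (hle : ∀ᶠ y in nhds x, u y ≤ v y) (heq : u x = v x) : fderiv ℝ u x = fderiv ℝ v x := by
  have hmin : IsLocalMin (v - u) x := by
    filter_upwards [hle] with y hy
    simp [heq, hy]
  have h := hmin.fderiv_eq_zero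
  rw [fderiv_sub hv hu, sub_eq_zero] at h
  exact h.symm

theorem deriv_eq_of_eventually_le_of_eq {u v : ℝ → ℝ} {x : ℝ} (hu : DifferentiableAt ℝ u x)
    (hv : DifferentiableAt ℝ v x) (hle : ∀ᶠ y in nhds x, u y ≤ v y) (heq : u x = v x) :
    deriv u x = deriv v x := by
  rw [← fderiv_apply_one_eq_deriv, ← fderiv_apply_one_eq_deriv,
    fderiv_eq_of_eventually_le_of_eq hu hv hle heq]

theorem norm_gradient_eq {E : Type*} [NormedAddCommGroup E] [InnerProductSpace ℝ E]
    [CompleteSpace E] (u : E → ℝ) (x : E) : ‖gradient u x‖ = ‖fderiv ℝ u x‖ := by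
  simp [gradient]

/-- A bounded measurable function vanishing outside a bounded set is integrable. -/
theorem integrable_of_bounded_of_eq_zero_off {E : Type*} [NormedAddCommGroup E] [NormedSpace ℝ E]
    [MeasurableSpace E] [BorelSpace E] [FiniteDimensional ℝ E] {μ : Measure E}
    [IsLocallyFiniteMeasure μ] {F : Type*} [NormedAddCommGroup F]
    {g : E → F} (hg : AEStronglyMeasurable g μ) {M : ℝ} (hM : ∀ x, ‖g x‖ ≤ M) {K : Set E}
    (hK : Bornology.IsBounded K) (h0 : ∀ x, x ∉ K → g x = 0) : Integrable g μ := by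
  have hc : IsCompact (closure K) := hK.isCompact_closure
  have h1 : IntegrableOn g (closure K) μ :=
    Measure.integrableOn_of_bounded (M := M) hc.measure_lt_top.ne hg
      (Filter.Eventually.of_forall hM)
  exact (integrableOn_iff_integrable_of_support_subset fun x hx => by
    by_contra h
    exact hx (h0 x fun hk => h (subset_closure hk))).1 h1

section Trial

variable {N : ℕ} {p : ℝ}

theorem bddBelow_rayleigh (p : ℝ) (U : Set (EuclideanSpace ℝ (Fin N))) :
    BddBelow { r : ℝ | ∃ φ, IsTestFun U φ ∧ φ ≠ 0 ∧
      r = (∫ x in U, ‖gradient φ x‖ ^ p) / (∫ x in U, |φ x| ^ p) } := by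
  refine ⟨0, ?_⟩
  rintro r ⟨φ, -, -, rfl⟩
  exact div_nonneg (integral_nonneg fun x => by positivity)
    (integral_nonneg fun x => by positivity)

theorem setIntegral_rayleigh_eq (hp : 0 < p) {U : Set (EuclideanSpace ℝ (Fin N))}
    {φ : EuclideanSpace ℝ (Fin N) → ℝ} (hφ : IsTestFun U φ) :
    (∫ x in U, ‖gradient φ x‖ ^ p) = (∫ x, ‖fderiv ℝ φ x‖ ^ p) ∧
      (∫ x in U, |φ x| ^ p) = ∫ x, |φ x| ^ p := by
  have hz : ∀ x, x ∉ U → x ∉ tsupport φ := fun x hx h => hx (hφ.2.2 h)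
  constructor
  · simp_rw [norm_gradient_eq]
    refine setIntegral_eq_integral_of_forall_compl_eq_zero fun x hx => ?_
    have : fderiv ℝ φ x = 0 := by
      by_contra h
      exact hz x hx (support_fderiv_subset ℝ h)
    simp [this, hp.ne']
  · refine setIntegral_eq_integral_of_forall_compl_eq_zero fun x hx => ?_
    simp [image_eq_zero_of_notMem_tsupport (hz x hx), hp.ne']

theorem pLambda1_mul_le_of_isTestFun (hp : 0 < p) {U : Set (EuclideanSpace ℝ (Fin N))}
    {φ : EuclideanSpace ℝ (Fin N) → ℝ} (hφ : IsTestFun U φ) :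
    pLambda1 p U * ∫ x, |φ x| ^ p ≤ ∫ x, ‖fderiv ℝ φ x‖ ^ p := by
  have hD : 0 ≤ ∫ x, ‖fderiv ℝ φ x‖ ^ p := integral_nonneg fun x => by positivity
  have hP : 0 ≤ ∫ x, |φ x| ^ p := integral_nonneg fun x => by positivity
  rcases hP.eq_or_lt with h | h
  · rw [← h, mul_zero]
    exact hD
  · have hne : φ ≠ 0 := by
      rintro rfl
      simp [hp.ne'] at h
    obtain ⟨h1, h2⟩ := setIntegral_rayleigh_eq hp hφ
    rw [← le_div_iff₀ h, ← h1, ← h2]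
    exact csInf_le (bddBelow_rayleigh p U) ⟨φ, hφ, hne, rfl⟩

open scoped Convolution in
theorem ContDiffBump.norm_normed_convolution_le {E V : Type*} [NormedAddCommGroup E]
    [InnerProductSpace ℝ E] [FiniteDimensional ℝ E] [MeasurableSpace E] [BorelSpace E]
    [NormedAddCommGroup V] [NormedSpace ℝ V]
    (b : ContDiffBump (0 : E)) {F : E → V} {M : ℝ} (hM : ∀ x, ‖F x‖ ≤ M) (x : E) :
    ‖(b.normed volume ⋆[ContinuousLinearMap.lsmul ℝ ℝ, volume] F) x‖ ≤ M := by
  have h : ‖∫ t, b.normed volume t • F (x - t)‖ ≤ ∫ t, b.normed volume t * M := by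
    refine norm_integral_le_of_norm_le (b.integrable_normed.mul_const M)
      (Filter.Eventually.of_forall fun t => ?_)
    rw [norm_smul, Real.norm_of_nonneg (b.nonneg_normed t)]
    exact mul_le_mul_of_nonneg_left (hM _) (b.nonneg_normed t)
  rw [integral_mul_const, b.integral_normed, one_mul] at h
  exact h

open scoped Convolution in
theorem LipschitzWith.fderiv_normed_convolution {E : Type*} [NormedAddCommGroup E]
    [InnerProductSpace ℝ E] [FiniteDimensional ℝ E] [MeasurableSpace E] [BorelSpace E]
    {C : NNReal} {u : E → ℝ}
    (hu : LipschitzWith C u) (b : ContDiffBump (0 : E)) (x : E) :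
    fderiv ℝ (b.normed volume ⋆[ContinuousLinearMap.lsmul ℝ ℝ, volume] u) x =
      (b.normed volume ⋆[ContinuousLinearMap.lsmul ℝ ℝ, volume] (fderiv ℝ u)) x := by
  have hcont := hu.continuous
  have hbc : Continuous (b.normed (volume : Measure E)) := b.continuous_normed
  refine HasFDerivAt.fderiv ?_
  refine (hasFDerivAt_integral_of_dominated_loc_of_lip (μ := volume) (s := univ) (x₀ := x)
    (F := fun y t => b.normed volume t • u (y - t))
    (F' := fun t => b.normed volume t • fderiv ℝ u (x - t))
    (bound := fun t => b.normed volume t * C) Filter.univ_mem ?_ ?_ ?_ ?_ ?_ ?_).2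
  · refine Filter.Eventually.of_forall fun y => Continuous.aestronglyMeasurable ?_
    fun_prop
  · refine Continuous.integrable_of_hasCompactSupport (by fun_prop) ?_
    exact b.hasCompactSupport_normed.smul_right
  · refine hbc.aestronglyMeasurable.smul ?_
    exact ((measurable_fderiv ℝ u).comp (measurable_const.sub measurable_id)).aestronglyMeasurable
  · refine Filter.Eventually.of_forall fun t => LipschitzOnWith.of_dist_le_mul fun y _ z _ => ?_
    rw [Real.dist_eq, ← smul_sub, smul_eq_mul, abs_mul, abs_of_nonneg (b.nonneg_normed t),
      Real.coe_nnabs, abs_mul, abs_of_nonneg (b.nonneg_normed t), NNReal.abs_eq, mul_assoc]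
    refine mul_le_mul_of_nonneg_left ?_ (b.nonneg_normed t)
    have := hu.dist_le_mul (y - t) (z - t)
    rwa [Real.dist_eq, dist_sub_right] at this
  · exact b.integrable_normed.mul_const _
  · have hq : Measure.QuasiMeasurePreserving (fun t : E => x - t) volume volume :=
      (Measure.measurePreserving_sub_left volume x).quasiMeasurePreserving
    filter_upwards [hq.ae (hu.ae_differentiableAt (μ := volume))] with t ht
    have h1 := ht.hasFDerivAt.comp x ((hasFDerivAt_id x).sub_const t)
    rw [ContinuousLinearMap.comp_id] at h1
    exact HasFDerivAt.const_smul (R := ℝ) h1 (b.normed volume t)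

open scoped Convolution Topology in
theorem pLambda1_mul_le_of_lipschitz_of_tsupport (hp : 0 < p)
    {U : Set (EuclideanSpace ℝ (Fin N))} (hU : IsOpen U)
    {u : EuclideanSpace ℝ (Fin N) → ℝ} {C : NNReal} (hu : LipschitzWith C u)
    (hc : HasCompactSupport u) (hsub : tsupport u ⊆ U) :
    pLambda1 p U * ∫ x, |u x| ^ p ≤ ∫ x, ‖fderiv ℝ u x‖ ^ p := by
  obtain ⟨δ, hδ, hδU⟩ := IsCompact.exists_cthickening_subset_open hc hU hsub
  have hcont := hu.continuous
  obtain ⟨M, hM⟩ := hc.exists_bound_of_continuous hcont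
  have hM0 : 0 ≤ M := (norm_nonneg _).trans (hM 0)
  have hpos : ∀ n : ℕ, 0 < δ * (1 / ((n : ℝ) + 1)) := fun n => by positivity
  let b : ℕ → ContDiffBump (0 : EuclideanSpace ℝ (Fin N)) := fun n =>
    { rIn := δ * (1 / ((n : ℝ) + 1)) / 2
      rOut := δ * (1 / ((n : ℝ) + 1))
      rIn_pos := by have := hpos n; positivity
      rIn_lt_rOut := by have := hpos n; linarith }
  have hb0 : Filter.Tendsto (fun n => (b n).rOut) Filter.atTop (𝓝 0) := by
    simpa only [mul_zero] using (tendsto_one_div_add_atTop_nhds_zero_nat (𝕜 := ℝ)).const_mul δ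
  have hbK : ∀ᶠ n in Filter.atTop, (b n).rOut ≤ 2 * (b n).rIn :=
    Filter.Eventually.of_forall fun n => by
      change δ * (1 / ((n : ℝ) + 1)) ≤ 2 * (δ * (1 / ((n : ℝ) + 1)) / 2)
      linarith
  have hbδ : ∀ n, (b n).rOut ≤ δ := fun n => by
    change δ * (1 / ((n : ℝ) + 1)) ≤ δ
    refine mul_le_of_le_one_right hδ.le ?_
    rw [div_le_one (by positivity)]
    have : (0 : ℝ) ≤ n := Nat.cast_nonneg n
    linarith
  set K := cthickening δ (tsupport u) with hKdef
  have hKc : IsCompact K := IsCompact.cthickening hc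
  let φ : ℕ → EuclideanSpace ℝ (Fin N) → ℝ := fun n =>
    (b n).normed volume ⋆[ContinuousLinearMap.lsmul ℝ ℝ, volume] u
  have hsupp : ∀ n, tsupport (φ n) ⊆ K := fun n => by
    refine closure_minimal ?_ isClosed_cthickening
    refine (support_convolution_subset _).trans ?_
    rintro _ ⟨a, ha, y, hy, rfl⟩
    rw [ContDiffBump.support_normed_eq, mem_ball_zero_iff] at ha
    refine mem_cthickening_of_dist_le _ y _ _ (subset_tsupport _ hy) ?_
    simpa using ha.le.trans (hbδ n)
  have htest : ∀ n, IsTestFun U (φ n) := fun n =>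
    ⟨(b n).hasCompactSupport_normed.contDiff_convolution_left _ (b n).contDiff_normed
      hcont.locallyIntegrable, hKc.of_isClosed_subset (isClosed_tsupport _) (hsupp n),
      (hsupp n).trans hδU⟩
  have hfd : ∀ n, fderiv ℝ (φ n) =
      (b n).normed volume ⋆[ContinuousLinearMap.lsmul ℝ ℝ, volume] (fderiv ℝ u) := fun n =>
    funext fun x => hu.fderiv_normed_convolution (b n) x
  have hgle : ∀ x, ‖fderiv ℝ u x‖ ≤ C := fun x => norm_fderiv_le_of_lipschitz ℝ hu
  have hlocg : LocallyIntegrable (fderiv ℝ u) (volume : Measure (EuclideanSpace ℝ (Fin N))) := by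
    have hm : AEStronglyMeasurable (fderiv ℝ u)
      (volume : Measure (EuclideanSpace ℝ (Fin N))) :=
      (measurable_fderiv ℝ u).aestronglyMeasurable
    refine (locallyIntegrable_const (C : ℝ)).mono hm (Filter.Eventually.of_forall fun x => ?_)
    exact (hgle x).trans (le_abs_self _)
  have hT1 : Filter.Tendsto (fun n => ∫ x, |φ n x| ^ p) Filter.atTop (𝓝 (∫ x, |u x| ^ p)) := by
    refine tendsto_integral_of_dominated_convergence (K.indicator fun _ => M ^ p) (fun n => ?_)
      ((integrableOn_const hKc.measure_lt_top.ne).integrable_indicator hKc.measurableSet)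
      (fun n => ?_) ?_
    · exact (((htest n).1.continuous.abs).rpow_const fun _ => Or.inr hp.le).aestronglyMeasurable
    · refine Filter.Eventually.of_forall fun x => ?_
      by_cases hx : x ∈ K
      · rw [indicator_of_mem hx, Real.norm_of_nonneg (by positivity)]
        exact Real.rpow_le_rpow (abs_nonneg _) ((b n).norm_normed_convolution_le hM x) hp.le
      · rw [image_eq_zero_of_notMem_tsupport fun h => hx (hsupp n h)]
        simp [hx, hp.ne']
    · filter_upwards [ContDiffBump.ae_convolution_tendsto_right_of_locallyIntegrable hb0 hbK
        (hcont.locallyIntegrable (μ := volume))] with x hx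
      exact (hx.abs).rpow_const (Or.inr hp.le)
  have hT2 : Filter.Tendsto (fun n => ∫ x, ‖fderiv ℝ (φ n) x‖ ^ p) Filter.atTop
      (𝓝 (∫ x, ‖fderiv ℝ u x‖ ^ p)) := by
    refine tendsto_integral_of_dominated_convergence (K.indicator fun _ => (C : ℝ) ^ p)
      (fun n => ?_)
      ((integrableOn_const hKc.measure_lt_top.ne).integrable_indicator hKc.measurableSet)
      (fun n => ?_) ?_
    · exact ((((htest n).1.continuous_fderiv (by simp)).norm).rpow_const
        fun _ => Or.inr hp.le).aestronglyMeasurable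
    · refine Filter.Eventually.of_forall fun x => ?_
      by_cases hx : x ∈ K
      · rw [indicator_of_mem hx, Real.norm_of_nonneg (by positivity), hfd]
        exact Real.rpow_le_rpow (norm_nonneg _) ((b n).norm_normed_convolution_le hgle x) hp.le
      · have h0 : fderiv ℝ (φ n) x = 0 := by
          by_contra h
          exact hx (hsupp n (support_fderiv_subset ℝ h))
        simp [hx, hp.ne', h0]
    · filter_upwards [ContDiffBump.ae_convolution_tendsto_right_of_locallyIntegrable hb0 hbK
        hlocg] with x hx
      simp_rw [hfd]
      exact (hx.norm).rpow_const (Or.inr hp.le)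
  exact le_of_tendsto_of_tendsto' (hT1.const_mul _) hT2 fun n =>
    pLambda1_mul_le_of_isTestFun hp (htest n)

theorem fderiv_eq_zero_of_notMem_closure {E : Type*} [NormedAddCommGroup E] [NormedSpace ℝ E]
    {u : E → ℝ} {K : Set E} (hz : ∀ x, x ∉ K → u x = 0) {x : E} (hx : x ∉ closure K) :
    fderiv ℝ u x = 0 := by
  have h : u =ᶠ[nhds x] fun _ => 0 := by
    filter_upwards [isClosed_closure.isOpen_compl.mem_nhds hx] with y hy
    exact hz y fun h => hy (subset_closure h)
  rw [h.fderiv_eq, fderiv_fun_const]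
  rfl

theorem integrable_norm_fderiv_rpow (hp : 0 < p) {u : EuclideanSpace ℝ (Fin N) → ℝ} {C : NNReal}
    (hu : LipschitzWith C u) {K : Set (EuclideanSpace ℝ (Fin N))} (hK : Bornology.IsBounded K)
    (hz : ∀ x, x ∉ K → u x = 0) : Integrable fun x => ‖fderiv ℝ u x‖ ^ p := by
  refine integrable_of_bounded_of_eq_zero_off (M := (C : ℝ) ^ p) ?_ (fun x => ?_) hK.closure
    fun x hx => ?_
  · exact ((measurable_fderiv ℝ u).norm.pow_const p).aestronglyMeasurable
  · rw [Real.norm_of_nonneg (by positivity)]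
    exact Real.rpow_le_rpow (norm_nonneg _) (norm_fderiv_le_of_lipschitz ℝ hu) hp.le
  · simp [fderiv_eq_zero_of_notMem_closure hz hx, hp.ne']

theorem integrable_abs_rpow_of_lipschitz (hp : 0 < p) {u : EuclideanSpace ℝ (Fin N) → ℝ}
    (hu : Continuous u) {K : Set (EuclideanSpace ℝ (Fin N))}
    (hK : Bornology.IsBounded K) (hz : ∀ x, x ∉ K → u x = 0) :
    Integrable fun x => |u x| ^ p := by
  have hc : HasCompactSupport u := HasCompactSupport.of_support_subset_isCompact
    hK.isCompact_closure fun x hx => by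
      by_contra h
      exact hx (hz x fun hk => h (subset_closure hk))
  refine Continuous.integrable_of_hasCompactSupport
    (hu.abs.rpow_const fun _ => Or.inr hp.le) ?_
  exact hc.comp_left (g := fun t : ℝ => |t| ^ p) (by simp [hp.ne'])

open scoped Topology in
theorem pLambda1_mul_le_of_lipschitz (hp : 0 < p)
    {U : Set (EuclideanSpace ℝ (Fin N))} (hU : IsOpen U) (hb : Bornology.IsBounded U)
    {u : EuclideanSpace ℝ (Fin N) → ℝ} {C : NNReal} (hu : LipschitzWith C u)
    (h0 : ∀ x, 0 ≤ u x) (hz : ∀ x, x ∉ U → u x = 0) :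
    pLambda1 p U * ∫ x, |u x| ^ p ≤ ∫ x, ‖fderiv ℝ u x‖ ^ p := by
  let e : ℕ → ℝ := fun k => 1 / ((k : ℝ) + 1)
  have he : ∀ k, 0 < e k := fun k => by positivity
  have het : Filter.Tendsto e Filter.atTop (𝓝 0) := tendsto_one_div_add_atTop_nhds_zero_nat
  let v : ℕ → EuclideanSpace ℝ (Fin N) → ℝ := fun k x => max (u x - e k) 0
  have hv : ∀ k, LipschitzWith C (v k) := fun k => LipschitzWith.of_dist_le_mul fun x y => by
    refine le_trans ?_ (hu.dist_le_mul x y)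
    rw [Real.dist_eq, Real.dist_eq]
    refine (abs_max_sub_max_le_abs _ _ _).trans (le_of_eq ?_)
    congr 1
    ring
  have hts : ∀ k, tsupport (v k) ⊆ U := fun k => by
    have h1 : tsupport (v k) ⊆ {x | e k ≤ u x} := by
      refine closure_minimal (fun x hx => ?_) (isClosed_le continuous_const hu.continuous)
      by_contra h
      refine hx (max_eq_right ?_)
      have : u x < e k := not_le.1 h
      linarith
    intro x hx
    by_contra h
    have h2 : e k ≤ u x := h1 hx
    rw [hz x h] at h2
    exact absurd h2 (not_le.2 (he k))
  have hvc : ∀ k, HasCompactSupport (v k) := fun k =>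
    hb.isCompact_closure.of_isClosed_subset (isClosed_tsupport _)
      ((hts k).trans subset_closure)
  have hle : ∀ k x, v k x ≤ u x := fun k x =>
    max_le (by linarith [he k]) (h0 x)
  have hv0 : ∀ k x, 0 ≤ v k x := fun k x => le_max_right _ _
  have hE : ∀ k, (∫ x, ‖fderiv ℝ (v k) x‖ ^ p) ≤ ∫ x, ‖fderiv ℝ u x‖ ^ p := fun k => by
    refine integral_mono_of_nonneg (Filter.Eventually.of_forall fun x => by positivity)
      (integrable_norm_fderiv_rpow hp hu hb hz) ?_
    filter_upwards [hu.ae_differentiableAt (μ := volume),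
      (hv k).ae_differentiableAt (μ := volume)] with x hx1 hx2
    refine Real.rpow_le_rpow (norm_nonneg _) ?_ hp.le
    rcases max_choice (u x - e k) 0 with h | h
    · have h1 := fderiv_eq_of_eventually_le_of_eq (u := fun y => u y - e k) (v := v k)
        (hx1.sub_const _) hx2 (Filter.Eventually.of_forall fun y => le_max_left _ _) h.symm
      rw [← h1, fderiv_sub_const]
    · have h1 := fderiv_eq_of_eventually_le_of_eq (u := fun y => 0) (v := v k)
        (differentiableAt_const _) hx2 (Filter.Eventually.of_forall fun y => le_max_right _ _)
        h.symm
      rw [← h1]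
      simp
  have hT : Filter.Tendsto (fun k => ∫ x, |v k x| ^ p) Filter.atTop (𝓝 (∫ x, |u x| ^ p)) := by
    refine tendsto_integral_of_dominated_convergence (fun x => |u x| ^ p) (fun k => ?_)
      (integrable_abs_rpow_of_lipschitz hp hu.continuous hb hz) (fun k => ?_) ?_
    · exact ((hv k).continuous.abs.rpow_const fun _ => Or.inr hp.le).aestronglyMeasurable
    · refine Filter.Eventually.of_forall fun x => ?_
      rw [Real.norm_of_nonneg (by positivity), abs_of_nonneg (hv0 k x), abs_of_nonneg (h0 x)]
      exact Real.rpow_le_rpow (hv0 k x) (hle k x) hp.le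
    · refine Filter.Eventually.of_forall fun x => ?_
      have h1 : Filter.Tendsto (fun k => v k x) Filter.atTop (𝓝 (u x)) := by
        have h2 := ((tendsto_const_nhds (x := u x)).sub het).max (tendsto_const_nhds (x := (0:ℝ)))
        rw [sub_zero, max_eq_left (h0 x)] at h2
        exact h2
      exact h1.abs.rpow_const (Or.inr hp.le)
  exact le_of_tendsto (hT.const_mul _) (Filter.Eventually.of_forall fun k =>
    (pLambda1_mul_le_of_lipschitz_of_tsupport hp hU (hv k) (hvc k) (hts k)).trans (hE k))

end Trial

section Radial

theorem norm_fderiv_comp_norm_sub_le {E : Type*} [NormedAddCommGroup E] [InnerProductSpace ℝ E]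
    {F : ℝ → ℝ} {c x : E} (hxc : x ≠ c)
    (hd : DifferentiableAt ℝ (fun y => F ‖y - c‖) x) :
    ‖fderiv ℝ (fun y => F ‖y - c‖) x‖ ≤ |deriv F ‖x - c‖| := by
  have hr : 0 < ‖x - c‖ := norm_pos_iff.2 (sub_ne_zero.2 hxc)
  set r := ‖x - c‖ with hrdef
  let γ : ℝ → E := fun s => c + s • (r⁻¹ • (x - c))
  have hγr : γ r = x := by
    simp [γ, smul_smul, hr.ne']
  have hγ : DifferentiableAt ℝ γ r := by fun_prop
  have hFd : DifferentiableAt ℝ F r := by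
    rw [← hγr] at hd
    refine (hd.comp r hγ).congr_of_eventuallyEq ?_
    filter_upwards [lt_mem_nhds hr] with s hs
    simp only [γ, Function.comp_apply, add_sub_cancel_left, norm_smul, norm_inv, Real.norm_eq_abs,
      abs_of_pos hr, abs_of_pos hs, ← hrdef]
    rw [inv_mul_cancel₀ hr.ne', mul_one]
  have hn : DifferentiableAt ℝ (fun y : E => ‖y - c‖) x :=
    (differentiableAt_id.sub_const c).norm ℝ (sub_ne_zero.2 hxc)
  have h1 : HasFDerivAt (fun y => F ‖y - c‖) (deriv F r • fderiv ℝ (fun y : E => ‖y - c‖) x) x :=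
    HasDerivAt.comp_hasFDerivAt x hFd.hasDerivAt hn.hasFDerivAt
  rw [h1.fderiv, norm_smul, Real.norm_eq_abs]
  refine mul_le_of_le_one_right (abs_nonneg _) ?_
  have hl : LipschitzWith 1 (fun y : E => ‖y - c‖) := LipschitzWith.of_dist_le_mul fun y z => by
    rw [NNReal.coe_one, one_mul, Real.dist_eq, dist_eq_norm]
    refine (abs_norm_sub_norm_le _ _).trans (le_of_eq ?_)
    congr 1
    abel
  exact norm_fderiv_le_of_lipschitz ℝ hl

/-- The area of the unit sphere of `ℝ^N`. -/
def sphereArea (N : ℕ) : ℝ := N * volume.real (ball (0 : EuclideanSpace ℝ (Fin N)) 1)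

theorem sphereArea_pos {N : ℕ} (hN : 2 ≤ N) : 0 < sphereArea N := by
  refine mul_pos (by exact_mod_cast (by omega : 0 < N)) ?_
  exact ENNReal.toReal_pos (measure_ball_pos _ _ one_pos).ne' measure_ball_lt_top.ne

theorem integral_comp_norm_sub {N : ℕ} (hN : 2 ≤ N) (g : ℝ → ℝ)
    (c : EuclideanSpace ℝ (Fin N)) :
    ∫ x, g ‖x - c‖ = sphereArea N * ∫ r in Ioi (0 : ℝ), r ^ (N - 1) * g r := by
  have : Nonempty (Fin N) := ⟨⟨0, by omega⟩⟩
  rw [integral_sub_right_eq_self (fun x => g ‖x‖) c, integral_fun_norm_addHaar volume g]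
  simp [sphereArea, mul_assoc]

end Radial

/-- Nonnegative Lipschitz functions on the line vanishing outside `(r0, r1)`. -/
structure IsProfile (r0 r1 : ℝ) (f : ℝ → ℝ) : Prop where
  lipschitz : ∃ C : NNReal, LipschitzWith C f
  nonneg : ∀ r, 0 ≤ f r
  eq_zero : ∀ r, r ∉ Ioo r0 r1 → f r = 0

/-- The `p`-energy of a radial profile with respect to the weight `r ^ n`. -/
def radialEnergy (p : ℝ) (n : ℕ) (f : ℝ → ℝ) : ℝ :=
  ∫ r in Ioi (0 : ℝ), r ^ n * |deriv f r| ^ p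

/-- The `p`-mass of a radial profile with respect to the weight `r ^ n`. -/
def radialMass (p : ℝ) (n : ℕ) (f : ℝ → ℝ) : ℝ :=
  ∫ r in Ioi (0 : ℝ), r ^ n * |f r| ^ p

theorem integrable_pow_mul {n : ℕ} {a b M : ℝ} (ha : 0 ≤ a) {g : ℝ → ℝ} (hg : Measurable g)
    (hM : ∀ r, |g r| ≤ M) (h0 : ∀ r, r ∉ Icc a b → g r = 0) :
    Integrable fun r => r ^ n * g r := by
  refine integrable_of_bounded_of_eq_zero_off (M := |b| ^ n * M) (K := Icc a b) ?_ (fun r => ?_)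
    (isBounded_Icc a b) fun r hr => by simp [h0 r hr]
  · exact ((measurable_id.pow_const n).mul hg).aestronglyMeasurable
  · have hM0 : 0 ≤ M := (abs_nonneg _).trans (hM 0)
    by_cases hr : r ∈ Icc a b
    · rw [norm_mul, norm_pow, Real.norm_eq_abs, Real.norm_eq_abs]
      have h1 : |r| ≤ |b| := abs_le_abs_of_nonneg (ha.trans hr.1) hr.2
      gcongr
      exact hM r
    · rw [h0 r hr, mul_zero, norm_zero]
      positivity

theorem deriv_eq_zero_of_notMem_Icc {r0 r1 : ℝ} {f : ℝ → ℝ} (h : ∀ r, r ∉ Ioo r0 r1 → f r = 0)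
    {r : ℝ} (hr : r ∉ Icc r0 r1) : deriv f r = 0 := by
  rw [← fderiv_apply_one_eq_deriv, fderiv_eq_zero_of_notMem_closure (K := Icc r0 r1)
    (fun s hs => h s fun h' => hs (Ioo_subset_Icc_self h')) (by rwa [isClosed_Icc.closure_eq])]
  rfl

theorem integrable_pow_mul_abs_rpow {p : ℝ} (hp : 0 < p) {n : ℕ} {a b M : ℝ} (ha : 0 ≤ a)
    {g : ℝ → ℝ} (hg : Measurable g) (hM : ∀ r, |g r| ≤ M) (h0 : ∀ r, r ∉ Icc a b → g r = 0) :
    Integrable fun r => r ^ n * |g r| ^ p := by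
  refine integrable_pow_mul (b := b) (M := M ^ p) ha (hg.abs.pow_const p)
    (fun r => ?_) fun r hr => ?_
  · rw [abs_of_nonneg (by positivity)]
    exact Real.rpow_le_rpow (abs_nonneg _) (hM r) hp.le
  · simp [h0 r hr, hp.ne']

namespace IsProfile

variable {r0 r1 p : ℝ} {n : ℕ} {f : ℝ → ℝ}

theorem exists_bound (hf : IsProfile r0 r1 f) : ∃ M, ∀ r, |f r| ≤ M := by
  obtain ⟨C, hC⟩ := hf.lipschitz
  have hc : HasCompactSupport f := HasCompactSupport.of_support_subset_isCompact
    (isCompact_Icc (a := r0) (b := r1)) fun x hx => by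
      by_contra h
      exact hx (hf.eq_zero x fun h' => h (Ioo_subset_Icc_self h'))
  exact hc.exists_bound_of_continuous hC.continuous

theorem integrable_energy (hf : IsProfile r0 r1 f) (hp : 0 < p) (hr0 : 0 ≤ r0) :
    Integrable fun r => r ^ n * |deriv f r| ^ p := by
  obtain ⟨C, hC⟩ := hf.lipschitz
  exact integrable_pow_mul_abs_rpow (M := C) hp hr0 (measurable_deriv f)
    (fun r => norm_deriv_le_of_lipschitz hC) fun r hr => deriv_eq_zero_of_notMem_Icc hf.eq_zero hr

theorem integrable_mass (hf : IsProfile r0 r1 f) (hp : 0 < p) (hr0 : 0 ≤ r0) :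
    Integrable fun r => r ^ n * |f r| ^ p := by
  obtain ⟨C, hC⟩ := hf.lipschitz
  obtain ⟨M, hM⟩ := hf.exists_bound
  exact integrable_pow_mul_abs_rpow hp hr0 hC.continuous.measurable hM
    fun r hr => hf.eq_zero r fun h' => hr (Ioo_subset_Icc_self h')

end IsProfile

section Polar

open Measure in
theorem integral_volumeIoiPow (n : ℕ) (F : ℝ → ℝ) :
    ∫ r : Ioi (0 : ℝ), F r ∂volumeIoiPow n = ∫ r in Ioi (0 : ℝ), r ^ n * F r := by
  simp only [Measure.volumeIoiPow, ENNReal.ofReal]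
  rw [integral_withDensity_eq_integral_smul,
    integral_subtype_comap measurableSet_Ioi fun a ↦ Real.toNNReal (a ^ n) • F a]
  · refine setIntegral_congr_fun measurableSet_Ioi fun x hx ↦ ?_
    simp only [NNReal.smul_def, Real.coe_toNNReal _ (pow_nonneg (mem_Ioi.1 hx).le _), smul_eq_mul]
  · exact (measurable_subtype_coe.pow_const _).real_toNNReal

theorem integral_polar {E : Type*} [NormedAddCommGroup E] [NormedSpace ℝ E]
    [FiniteDimensional ℝ E] [Nontrivial E] [MeasurableSpace E] [BorelSpace E] (μ : Measure E)
    [μ.IsAddHaarMeasure] {n : ℕ} (hn : Module.finrank ℝ E - 1 = n) {h : E → ℝ}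
    (hi : Integrable h μ) :
    Integrable (fun θ : sphere (0 : E) 1 => ∫ r in Ioi (0 : ℝ), r ^ n * h (r • (θ : E)))
      μ.toSphere ∧
    ∫ x, h x ∂μ = ∫ θ : sphere (0 : E) 1,
      (∫ r in Ioi (0 : ℝ), r ^ n * h (r • (θ : E))) ∂μ.toSphere := by
  have hmp := μ.measurePreserving_homeomorphUnitSphereProd
  rw [hn] at hmp
  let G : sphere (0 : E) 1 × Ioi (0 : ℝ) → ℝ := fun z => h ((z.2 : ℝ) • (z.1 : E))
  have hG : ∀ x : ({0}ᶜ : Set E), G (homeomorphUnitSphereProd E x) = h x := fun x => by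
    have hx : ‖(x : E)‖ ≠ 0 := norm_ne_zero_iff.2 x.2
    simp only [G, homeomorphUnitSphereProd_apply_snd_coe, homeomorphUnitSphereProd_apply_fst_coe,
      smul_smul, mul_inv_cancel₀ hx, one_smul]
  have hGi : Integrable G (μ.toSphere.prod (Measure.volumeIoiPow n)) := by
    rw [← hmp.integrable_comp_emb (Homeomorph.measurableEmbedding _)]
    have h1 : IntegrableOn h ({0}ᶜ : Set E) μ := hi.integrableOn
    rw [integrableOn_iff_comap_subtypeVal (measurableSet_singleton _).compl] at h1
    exact h1.congr (Filter.Eventually.of_forall fun x => (hG x).symm)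
  have hin : ∀ θ : sphere (0 : E) 1, ∫ r, G (θ, r) ∂Measure.volumeIoiPow n =
      ∫ r in Ioi (0 : ℝ), r ^ n * h (r • (θ : E)) := fun θ =>
    integral_volumeIoiPow n fun r => h (r • (θ : E))
  refine ⟨?_, ?_⟩
  · have h1 := hGi.integral_prod_left
    simp_rw [hin] at h1
    exact h1
  · calc ∫ x, h x ∂μ = ∫ x : ({0}ᶜ : Set E), h (x : E) ∂(μ.comap Subtype.val) := by
          rw [integral_subtype_comap (measurableSet_singleton _).compl h,
            restrict_compl_singleton]
      _ = ∫ z, G z ∂(μ.toSphere.prod (Measure.volumeIoiPow n)) := by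
          rw [← hmp.integral_comp (Homeomorph.measurableEmbedding _)]
          simp_rw [hG]
      _ = _ := by
          rw [integral_prod _ hGi]
          simp_rw [hin]

end Polar

section RadialReduction

variable {N : ℕ} {p r0 r1 : ℝ}

theorem mul_integral_le_of_forall_profile (hN : 2 ≤ N) (hp : 0 < p) (hr0 : 0 < r0) {l : ℝ}
    (hl : ∀ f, IsProfile r0 r1 f → l * radialMass p (N - 1) f ≤ radialEnergy p (N - 1) f)
    {φ : EuclideanSpace ℝ (Fin N) → ℝ} (hφ : IsTestFun (ball 0 r1 \ closure (ball 0 r0)) φ) :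
    l * ∫ x, |φ x| ^ p ≤ ∫ x, ‖fderiv ℝ φ x‖ ^ p := by
  obtain ⟨C, hC⟩ := ContDiff.lipschitzWith_of_hasCompactSupport hφ.2.1 hφ.1 (by simp)
  have hzero : ∀ x, x ∉ ball (0 : EuclideanSpace ℝ (Fin N)) r1 \ closure (ball 0 r0) → φ x = 0 :=
    fun x hx => image_eq_zero_of_notMem_tsupport fun h => hx (hφ.2.2 h)
  have hdzero : ∀ x, x ∉ ball (0 : EuclideanSpace ℝ (Fin N)) r1 \ closure (ball 0 r0) →
      fderiv ℝ φ x = 0 := fun x hx => by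
    by_contra h
    exact hx (hφ.2.2 (support_fderiv_subset ℝ h))
  have hbdd : Bornology.IsBounded (ball (0 : EuclideanSpace ℝ (Fin N)) r1 \ closure (ball 0 r0)) :=
    isBounded_ball.subset sdiff_subset
  have : Nonempty (Fin N) := ⟨⟨0, by omega⟩⟩
  have hfr : Module.finrank ℝ (EuclideanSpace ℝ (Fin N)) - 1 = N - 1 := by simp
  obtain ⟨hi1, he1⟩ := integral_polar volume hfr
    (integrable_abs_rpow_of_lipschitz hp hC.continuous hbdd hzero)
  obtain ⟨hi2, he2⟩ :=
    integral_polar volume hfr (integrable_norm_fderiv_rpow hp hC hbdd hzero)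
  rw [he1, he2, ← integral_const_mul]
  refine integral_mono (hi1.const_mul l) hi2 fun θ => ?_
  have hθ : ‖(θ : EuclideanSpace ℝ (Fin N))‖ = 1 := by simp
  have hmem : ∀ r : ℝ, r ∉ Ioo r0 r1 → max r 0 • (θ : EuclideanSpace ℝ (Fin N)) ∉
      ball (0 : EuclideanSpace ℝ (Fin N)) r1 \ closure (ball 0 r0) := fun r hr hx => by
    rw [closure_ball _ hr0.ne', mem_sdiff, mem_ball_zero_iff, mem_closedBall_zero_iff, norm_smul,
      hθ,
      mul_one, Real.norm_of_nonneg (le_max_right _ _), not_le] at hx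
    have hpos : 0 < r := by
      by_contra h
      rw [max_eq_right (not_lt.1 h)] at hx
      linarith [hx.2]
    rw [max_eq_left hpos.le] at hx
    exact hr ⟨hx.2, hx.1⟩
  let f : ℝ → ℝ := fun r => |φ (max r 0 • (θ : EuclideanSpace ℝ (Fin N)))|
  have hfLip : LipschitzWith C f := LipschitzWith.of_dist_le_mul fun r s => by
    rw [Real.dist_eq]
    refine (abs_abs_sub_abs_le _ _).trans ?_
    rw [← Real.dist_eq]
    refine (hC.dist_le_mul _ _).trans (mul_le_mul_of_nonneg_left ?_ C.2)
    rw [dist_eq_norm, ← sub_smul, norm_smul, hθ, mul_one, Real.norm_eq_abs, Real.dist_eq]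
    exact abs_max_sub_max_le_abs _ _ _
  have hf : IsProfile r0 r1 f :=
    ⟨⟨C, hfLip⟩, fun r => abs_nonneg _, fun r hr => by simp [f, hzero _ (hmem r hr)]⟩
  have hmass : (∫ r in Ioi (0 : ℝ), r ^ (N - 1) * |φ (r • (θ : EuclideanSpace ℝ (Fin N)))| ^ p) =
      radialMass p (N - 1) f := by
    refine setIntegral_congr_fun measurableSet_Ioi fun r hr => ?_
    simp only [f, abs_abs, max_eq_left (mem_Ioi.1 hr).le]
  change l * (∫ r in Ioi (0 : ℝ), r ^ (N - 1) * |φ (r • (θ : EuclideanSpace ℝ (Fin N)))| ^ p) ≤ _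
  rw [hmass]
  refine (hl f hf).trans ?_
  have hgi : IntegrableOn (fun r : ℝ => r ^ (N - 1) *
      ‖fderiv ℝ φ (r • (θ : EuclideanSpace ℝ (Fin N)))‖ ^ p) (Ioi 0) := by
    have h1 : Integrable fun r : ℝ => r ^ (N - 1) *
        |‖fderiv ℝ φ (max r 0 • (θ : EuclideanSpace ℝ (Fin N)))‖| ^ p := by
      refine integrable_pow_mul_abs_rpow (a := r0) (b := r1) (M := C) hp hr0.le ?_ (fun r => ?_)
        fun r hr => ?_
      · have := hφ.1.continuous_fderiv (by simp)
        exact Continuous.measurable (by fun_prop)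
      · rw [abs_norm]
        exact norm_fderiv_le_of_lipschitz ℝ hC
      · rw [hdzero _ (hmem r fun h => hr (Ioo_subset_Icc_self h)), norm_zero]
    refine h1.integrableOn.congr_fun (fun r hr => ?_) measurableSet_Ioi
    simp only [abs_norm, max_eq_left (mem_Ioi.1 hr).le]
  refine setIntegral_mono_ae_restrict (hf.integrable_energy hp hr0.le).integrableOn hgi ?_
  filter_upwards [ae_restrict_mem measurableSet_Ioi,
    ae_restrict_of_ae (hfLip.ae_differentiableAt (μ := volume))] with r hr hd
  have hr' : 0 < r := hr
  have hline : HasDerivAt (fun s : ℝ => φ (s • (θ : EuclideanSpace ℝ (Fin N))))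
      (fderiv ℝ φ (r • (θ : EuclideanSpace ℝ (Fin N))) θ) r := by
    have h1 : HasDerivAt (fun s : ℝ => s • (θ : EuclideanSpace ℝ (Fin N)))
        (θ : EuclideanSpace ℝ (Fin N)) r := by
      simpa using (hasDerivAt_id r).smul_const (θ : EuclideanSpace ℝ (Fin N))
    exact ((hφ.1.differentiable (by simp)) _).hasFDerivAt.comp_hasDerivAt r h1
  have hloc : ∀ᶠ s in nhds r, f s = |φ (s • (θ : EuclideanSpace ℝ (Fin N)))| := by
    filter_upwards [lt_mem_nhds hr'] with s hs
    simp only [f, max_eq_left hs.le]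
  have hder : |deriv f r| ≤ ‖fderiv ℝ φ (r • (θ : EuclideanSpace ℝ (Fin N)))‖ := by
    have hb : |fderiv ℝ φ (r • (θ : EuclideanSpace ℝ (Fin N))) θ| ≤
        ‖fderiv ℝ φ (r • (θ : EuclideanSpace ℝ (Fin N)))‖ := by
      simpa [hθ] using (fderiv ℝ φ (r • (θ : EuclideanSpace ℝ (Fin N)))).le_opNorm
        (θ : EuclideanSpace ℝ (Fin N))
    rcases abs_choice (φ (r • (θ : EuclideanSpace ℝ (Fin N)))) with h | h
    · have h1 := deriv_eq_of_eventually_le_of_eq hline.differentiableAt hd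
        (hloc.mono fun s hs => hs ▸ le_abs_self _) (by rw [hloc.self_of_nhds, h])
      rwa [← h1, hline.deriv]
    · have h1 := deriv_eq_of_eventually_le_of_eq hline.neg.differentiableAt hd
        (hloc.mono fun s hs => hs ▸ neg_le_abs _) (by rw [hloc.self_of_nhds, h]; rfl)
      rwa [← h1, hline.neg.deriv, abs_neg]
  exact mul_le_mul_of_nonneg_left (Real.rpow_le_rpow (abs_nonneg _) hder hp.le)
    (pow_nonneg hr'.le _)

end RadialReduction

theorem le_add_inv_rpow_mul_rpow {p L y : ℝ} (hp : 1 < p) (hL : 0 < L) (hy : 0 ≤ y) :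
    y ≤ L + (L ^ (p - 1))⁻¹ * y ^ p := by
  rcases le_total y L with h | h
  · have : 0 ≤ (L ^ (p - 1))⁻¹ * y ^ p := by positivity
    linarith
  · have hy0 : 0 < y := hL.trans_le h
    have h1 : y ^ p = y ^ (p - 1) * y := by
      rw [← Real.rpow_add_one hy0.ne']
      ring_nf
    have h2 : L ^ (p - 1) ≤ y ^ (p - 1) := Real.rpow_le_rpow hL.le h (by linarith)
    have h3 : y ≤ (L ^ (p - 1))⁻¹ * y ^ p := by
      rw [h1, inv_mul_eq_div, le_div_iff₀ (by positivity)]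
      nlinarith
    linarith

namespace IsProfile

variable {r0 r1 p : ℝ} {n : ℕ} {f : ℝ → ℝ}

theorem continuous (hf : IsProfile r0 r1 f) : Continuous f := by
  obtain ⟨C, hC⟩ := hf.lipschitz
  exact hC.continuous

theorem deriv_eq_zero (hf : IsProfile r0 r1 f) {r : ℝ} (hr : r ∉ Icc r0 r1) : deriv f r = 0 :=
  deriv_eq_zero_of_notMem_Icc hf.eq_zero hr

theorem energy_density_nonneg (hf : IsProfile r0 r1 f) (hp : 0 < p) (hr0 : 0 ≤ r0) (r : ℝ) :
    0 ≤ r ^ n * |deriv f r| ^ p := by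
  by_cases hr : r ∈ Icc r0 r1
  · have := hr0.trans hr.1
    positivity
  · simp [hf.deriv_eq_zero hr, hp.ne']

theorem mass_density_nonneg (hf : IsProfile r0 r1 f) (hp : 0 < p) (hr0 : 0 ≤ r0) (r : ℝ) :
    0 ≤ r ^ n * |f r| ^ p := by
  by_cases hr : r ∈ Ioo r0 r1
  · have := hr0.trans hr.1.le
    positivity
  · simp [hf.eq_zero r hr, hp.ne']

theorem radialEnergy_eq_integral (hf : IsProfile r0 r1 f) (hp : 0 < p) (hr0 : 0 < r0) :
    radialEnergy p n f = ∫ r, r ^ n * |deriv f r| ^ p :=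
  setIntegral_eq_integral_of_forall_compl_eq_zero fun r hr => by
    simp [hf.deriv_eq_zero fun h => hr (hr0.trans_le h.1), hp.ne']

theorem radialMass_eq_integral (hf : IsProfile r0 r1 f) (hp : 0 < p) (hr0 : 0 < r0) :
    radialMass p n f = ∫ r, r ^ n * |f r| ^ p :=
  setIntegral_eq_integral_of_forall_compl_eq_zero fun r hr => by
    simp [hf.eq_zero r fun h => hr (hr0.trans h.1), hp.ne']

theorem radialEnergy_nonneg (hf : IsProfile r0 r1 f) (hp : 0 < p) (hr0 : 0 < r0) :
    0 ≤ radialEnergy p n f := by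
  rw [hf.radialEnergy_eq_integral hp hr0]
  exact integral_nonneg fun r => hf.energy_density_nonneg hp hr0.le r

theorem abs_sub_le_of_le (hf : IsProfile r0 r1 f) (hp : 1 < p) (hr0 : 0 < r0) {L : ℝ} (hL : 0 < L)
    {a b : ℝ} (hab : a ≤ b) :
    |f b - f a| ≤ L * (b - a) + (L ^ (p - 1))⁻¹ * (r0 ^ n)⁻¹ * radialEnergy p n f := by
  have hp0 : 0 < p := by linarith
  obtain ⟨C, hC⟩ := hf.lipschitz
  have hint := hf.integrable_energy (n := n) hp0 hr0.le
  set g : ℝ → ℝ := fun r => r ^ n * |deriv f r| ^ p with hg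
  set K : ℝ := (L ^ (p - 1))⁻¹ * (r0 ^ n)⁻¹ with hK
  have hK0 : 0 ≤ K := by positivity
  have hftc : ∫ x in a..b, deriv f x = f b - f a :=
    (hC.lipschitzOnWith (s := uIcc a b)).absolutelyContinuousOnInterval.integral_deriv_eq_sub
  have hd : IntervalIntegrable (deriv f) volume a b :=
    (hC.lipschitzOnWith (s := uIcc a b)).absolutelyContinuousOnInterval.intervalIntegrable_deriv
  have hpt : ∀ r, |deriv f r| ≤ L + K * g r := fun r => by
    by_cases hr : r ∈ Icc r0 r1
    · refine (le_add_inv_rpow_mul_rpow hp hL (abs_nonneg _)).trans ?_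
      have h1 : r0 ^ n ≤ r ^ n := pow_le_pow_left₀ hr0.le hr.1 n
      have h2 : |deriv f r| ^ p ≤ (r0 ^ n)⁻¹ * g r := by
        rw [inv_mul_eq_div, le_div_iff₀ (by positivity), mul_comm]
        exact mul_le_mul_of_nonneg_right h1 (by positivity)
      rw [hK, mul_assoc]
      gcongr
    · rw [hf.deriv_eq_zero hr, abs_zero]
      have := hf.energy_density_nonneg (n := n) hp0 hr0.le r
      positivity
  rw [← hftc, hf.radialEnergy_eq_integral hp0 hr0]
  have hii : IntervalIntegrable (fun r => L + K * g r) volume a b :=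
    intervalIntegrable_const.add ((hint.const_mul K).intervalIntegrable)
  calc |∫ x in a..b, deriv f x| ≤ ∫ x in a..b, |deriv f x| :=
        intervalIntegral.abs_integral_le_integral_abs hab
    _ ≤ ∫ x in a..b, (L + K * g x) :=
        intervalIntegral.integral_mono hab hd.abs hii hpt
    _ = L * (b - a) + K * ∫ x in a..b, g x := by
        rw [intervalIntegral.integral_add intervalIntegrable_const
          ((hint.const_mul K).intervalIntegrable), intervalIntegral.integral_const,
          intervalIntegral.integral_const_mul, smul_eq_mul, mul_comm]
    _ ≤ _ := by
        gcongr
        rw [intervalIntegral.integral_of_le hab]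
        exact setIntegral_le_integral hint
          (Filter.Eventually.of_forall fun r => hf.energy_density_nonneg hp0 hr0.le r)

/-- A uniform modulus of continuity in terms of the energy. -/
theorem abs_sub_le (hf : IsProfile r0 r1 f) (hp : 1 < p) (hr0 : 0 < r0) {L : ℝ} (hL : 0 < L)
    (a b : ℝ) :
    |f b - f a| ≤ L * |b - a| + (L ^ (p - 1))⁻¹ * (r0 ^ n)⁻¹ * radialEnergy p n f := by
  rcases le_total a b with h | h
  · rw [abs_of_nonneg (sub_nonneg.2 h)]
    exact hf.abs_sub_le_of_le hp hr0 hL h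
  · rw [abs_sub_comm, abs_sub_comm b a, abs_of_nonneg (sub_nonneg.2 h)]
    exact hf.abs_sub_le_of_le hp hr0 hL h

theorem mem_Ioo_of_ne_zero (hf : IsProfile r0 r1 f) {r : ℝ} (h : f r ≠ 0) : r ∈ Ioo r0 r1 := by
  by_contra hr
  exact h (hf.eq_zero r hr)

theorem hasCompactSupport (hf : IsProfile r0 r1 f) : HasCompactSupport f :=
  HasCompactSupport.of_support_subset_isCompact (isCompact_Icc (a := r0) (b := r1))
    fun _ hx => Ioo_subset_Icc_self (hf.mem_Ioo_of_ne_zero hx)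

theorem radialMass_pos (hf : IsProfile r0 r1 f) (hp : 0 < p) (hr0 : 0 < r0) {ρ : ℝ}
    (hρ : f ρ ≠ 0) : 0 < radialMass p n f := by
  rw [hf.radialMass_eq_integral hp hr0]
  refine Continuous.integral_pos_of_hasCompactSupport_nonneg_nonzero (x := ρ) ?_ ?_
    (fun r => hf.mass_density_nonneg hp hr0.le r) ?_
  · exact (continuous_pow n).mul (hf.continuous.abs.rpow_const fun _ => Or.inr hp.le)
  · refine hf.hasCompactSupport.mono fun x hx => ?_
    rw [Function.mem_support] at hx ⊢
    contrapose! hx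
    simp [hx, hp.ne']
  · have := hr0.trans (hf.mem_Ioo_of_ne_zero hρ).1
    have := abs_pos.2 hρ
    positivity

theorem radialMass_le (hf : IsProfile r0 r1 f) (hp : 0 < p) (hr0 : 0 < r0) (hr01 : r0 < r1)
    (hf1 : ∀ r, f r ≤ 1) : radialMass p n f ≤ r1 ^ n * (r1 - r0) := by
  rw [hf.radialMass_eq_integral hp hr0]
  calc ∫ r, r ^ n * |f r| ^ p ≤ ∫ r, (Icc r0 r1).indicator (fun _ => r1 ^ n) r := by
        refine integral_mono (hf.integrable_mass hp hr0.le)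
          ((integrable_indicator_iff measurableSet_Icc).2 (by simp)) fun r => ?_
        by_cases hr : r ∈ Icc r0 r1
        · have h1 : |f r| ^ p ≤ 1 :=
            Real.rpow_le_one (abs_nonneg _) (by rw [abs_of_nonneg (hf.nonneg r)]; exact hf1 r) hp.le
          have h2 : r ^ n ≤ r1 ^ n := pow_le_pow_left₀ (hr0.le.trans hr.1) hr.2 n
          have h3 : 0 ≤ r ^ n := pow_nonneg (hr0.le.trans hr.1) n
          simp only [indicator_of_mem hr]
          nlinarith
        · simp [indicator_of_notMem hr, hf.eq_zero r fun h => hr (Ioo_subset_Icc_self h), hp.ne']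
    _ = r1 ^ n * (r1 - r0) := by
        rw [integral_indicator measurableSet_Icc, setIntegral_const, measureReal_def,
          Real.volume_Icc, ENNReal.toReal_ofReal (by linarith), smul_eq_mul, mul_comm]

end IsProfile

/-- The radial first eigenvalue: the infimum of the Rayleigh quotients of nonnegative profiles
with maximum one. -/
def radialLambda (p : ℝ) (n : ℕ) (r0 r1 : ℝ) : ℝ :=
  sInf {x | ∃ f, IsProfile r0 r1 f ∧ (∀ r, f r ≤ 1) ∧ (∃ ρ, f ρ = 1) ∧
    x = radialEnergy p n f / radialMass p n f}

section RadialLambda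

variable {r0 r1 p : ℝ} {n : ℕ}

theorem exists_isProfile (hr01 : r0 < r1) :
    ∃ f, IsProfile r0 r1 f ∧ (∀ r, f r ≤ 1) ∧ ∃ ρ, f ρ = 1 := by
  have hd : 0 < r1 - r0 := sub_pos.2 hr01
  refine ⟨fun r => max (1 - 2 / (r1 - r0) * |r - (r0 + r1) / 2|) 0, ⟨?_, fun r => le_max_right _ _,
    fun r hr => ?_⟩, fun r => ?_, (r0 + r1) / 2, ?_⟩
  · refine ⟨Real.toNNReal (2 / (r1 - r0)), LipschitzWith.of_dist_le_mul fun x y => ?_⟩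
    rw [Real.dist_eq, Real.dist_eq, Real.coe_toNNReal _ (by positivity)]
    refine (abs_max_sub_max_le_abs _ _ _).trans ?_
    have h := abs_abs_sub_abs_le_abs_sub (y - (r0 + r1) / 2) (x - (r0 + r1) / 2)
    rw [sub_sub_sub_cancel_left, ← mul_sub, abs_mul,
      abs_of_nonneg (by positivity : 0 ≤ 2 / (r1 - r0))]
    rw [sub_sub_sub_cancel_right] at h
    rw [abs_sub_comm x y]
    exact mul_le_mul_of_nonneg_left h (by positivity)
  · refine max_eq_right ?_
    have h1 : (r1 - r0) / 2 ≤ |r - (r0 + r1) / 2| := by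
      by_contra! h
      rw [abs_lt] at h
      exact hr ⟨by linarith [h.1], by linarith [h.2]⟩
    have h2 : 2 / (r1 - r0) * ((r1 - r0) / 2) = 1 := by field_simp
    have h3 : 2 / (r1 - r0) * ((r1 - r0) / 2) ≤ 2 / (r1 - r0) * |r - (r0 + r1) / 2| := by gcongr
    linarith
  · have : 0 ≤ 2 / (r1 - r0) * |r - (r0 + r1) / 2| := by positivity
    exact max_le (by linarith) zero_le_one
  · simp

theorem radialLambda_pos (hp : 1 < p) (hr0 : 0 < r0) (hr01 : r0 < r1) :
    0 < radialLambda p n r0 r1 := by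
  have hd : 0 < r1 - r0 := sub_pos.2 hr01
  have hr1 : 0 < r1 := hr0.trans hr01
  have hp0 : 0 < p := by linarith
  set L : ℝ := 1 / (2 * (r1 - r0)) with hL
  have hL0 : 0 < L := by positivity
  set K : ℝ := (L ^ (p - 1))⁻¹ * (r0 ^ n)⁻¹ with hK
  have hK0 : 0 < K := by positivity
  have hpos : 0 < (1 / (2 * K)) / (r1 ^ n * (r1 - r0)) := by positivity
  refine hpos.trans_le (le_csInf ?_ ?_)
  · obtain ⟨f, h1, h2, h3⟩ := exists_isProfile hr01
    exact ⟨_, f, h1, h2, h3, rfl⟩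
  · rintro _ ⟨f, hf, hf1, ⟨ρ, hρ⟩, rfl⟩
    have hρI := hf.mem_Ioo_of_ne_zero (r := ρ) (by simp [hρ])
    have hm := hf.radialMass_pos (n := n) hp0 hr0 (ρ := ρ) (by simp [hρ])
    have h := hf.abs_sub_le (n := n) hp hr0 hL0 r0 ρ
    rw [hρ, hf.eq_zero r0 (by simp), sub_zero, abs_one, abs_of_pos (sub_pos.2 hρI.1)] at h
    have h2 : L * (ρ - r0) ≤ 1 / 2 := by
      calc L * (ρ - r0) ≤ L * (r1 - r0) := by gcongr; exact hρI.2.le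
        _ = 1 / 2 := by rw [hL]; field_simp
    have h3 : 1 / (2 * K) ≤ radialEnergy p n f := by
      rw [div_le_iff₀ (by positivity)]
      linarith
    exact div_le_div₀ (hf.radialEnergy_nonneg hp0 hr0) h3 hm (hf.radialMass_le hp0 hr0 hr01 hf1)

theorem radialLambda_mul_le (hp : 1 < p) (hr0 : 0 < r0) {f : ℝ → ℝ} (hf : IsProfile r0 r1 f) :
    radialLambda p n r0 r1 * radialMass p n f ≤ radialEnergy p n f := by
  have hp0 : 0 < p := by linarith
  obtain ⟨ρ, hρ⟩ := hf.continuous.exists_forall_ge_of_hasCompactSupport hf.hasCompactSupport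
  rcases (hf.nonneg ρ).eq_or_lt' with h0 | h0
  · have hz : ∀ r, f r = 0 := fun r => le_antisymm (h0 ▸ hρ r) (hf.nonneg r)
    have : radialMass p n f = 0 := by simp [radialMass, hz, hp0.ne']
    rw [this, mul_zero]
    exact hf.radialEnergy_nonneg hp0 hr0
  set m := f ρ with hm
  have hg : IsProfile r0 r1 fun r => f r / m := by
    refine ⟨?_, fun r => div_nonneg (hf.nonneg r) h0.le, fun r hr => by simp [hf.eq_zero r hr]⟩
    obtain ⟨C, hC⟩ := hf.lipschitz
    refine ⟨C * Real.toNNReal m⁻¹, LipschitzWith.of_dist_le_mul fun x y => ?_⟩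
    have := hC.dist_le_mul x y
    rw [Real.dist_eq] at *
    rw [← sub_div, abs_div, abs_of_pos h0, NNReal.coe_mul, Real.coe_toNNReal _ (by positivity),
      div_eq_mul_inv]
    calc |f x - f y| * m⁻¹ ≤ C * dist x y * m⁻¹ := by gcongr
      _ = _ := by ring
  have hmp : 0 < m ^ p := by positivity
  have hmass : radialMass p n (fun r => f r / m) = radialMass p n f / m ^ p := by
    rw [radialMass, radialMass, ← integral_div]
    congr 1 with r
    rw [abs_div, abs_of_pos h0, Real.div_rpow (abs_nonneg _) h0.le, mul_div_assoc]
  have hen : radialEnergy p n (fun r => f r / m) = radialEnergy p n f / m ^ p := by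
    rw [radialEnergy, radialEnergy, ← integral_div]
    congr 1 with r
    rw [deriv_div_const, abs_div, abs_of_pos h0, Real.div_rpow (abs_nonneg _) h0.le, mul_div_assoc]
  have hbdd : BddBelow {x | ∃ f, IsProfile r0 r1 f ∧ (∀ r, f r ≤ 1) ∧ (∃ ρ, f ρ = 1) ∧
      x = radialEnergy p n f / radialMass p n f} := by
    refine ⟨0, ?_⟩
    rintro _ ⟨f, hf, -, ⟨ρ, hρ⟩, rfl⟩
    exact div_nonneg (hf.radialEnergy_nonneg hp0 hr0)
      (hf.radialMass_pos hp0 hr0 (ρ := ρ) (by simp [hρ])).le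
  have h := csInf_le hbdd ⟨_, hg, fun r => (div_le_one h0).2 (hρ r), ⟨ρ, div_self h0.ne'⟩, rfl⟩
  have hfm := hf.radialMass_pos (n := n) hp0 hr0 (ρ := ρ) h0.ne'
  rw [hmass, hen, div_div_div_cancel_right₀ hmp.ne', le_div_iff₀ hfm] at h
  exact h

theorem exists_isProfile_radialEnergy_lt (hp : 1 < p) (hr0 : 0 < r0) (hr01 : r0 < r1) {ε : ℝ}
    (hε : 0 < ε) : ∃ f ρ, IsProfile r0 r1 f ∧ (∀ r, f r ≤ 1) ∧ f ρ = 1 ∧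
      radialEnergy p n f < radialLambda p n r0 r1 * radialMass p n f + ε := by
  have hp0 : 0 < p := by linarith
  have hd : 0 < r1 - r0 := sub_pos.2 hr01
  have hr1 : 0 < r1 := hr0.trans hr01
  have hB : 0 < r1 ^ n * (r1 - r0) := by positivity
  obtain ⟨_, ⟨f, hf, hf1, ⟨ρ, hρ⟩, rfl⟩, hlt⟩ := exists_lt_of_csInf_lt (by
    obtain ⟨f, h1, h2, h3⟩ := exists_isProfile hr01
    exact ⟨_, f, h1, h2, h3, rfl⟩)
    (lt_add_of_pos_right (radialLambda p n r0 r1) (div_pos hε hB))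
  refine ⟨f, ρ, hf, hf1, hρ, ?_⟩
  have hm := hf.radialMass_pos (n := n) hp0 hr0 (ρ := ρ) (by simp [hρ])
  rw [div_lt_iff₀ hm, add_mul] at hlt
  refine hlt.trans_le ?_
  gcongr
  rw [div_mul_eq_mul_div, div_le_iff₀ hB]
  gcongr
  exact hf.radialMass_le hp0 hr0 hr01 hf1

end RadialLambda

theorem lipschitzWith_tent (q τ m d : ℝ) (hτ : 0 ≤ τ) :
    LipschitzWith (Real.toNNReal τ) fun s : ℝ => q + τ * (d - |s - m|) :=
  LipschitzWith.of_dist_le_mul fun x y => by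
    have h := abs_abs_sub_abs_le_abs_sub (y - m) (x - m)
    rw [sub_sub_sub_cancel_right] at h
    rw [Real.dist_eq, Real.dist_eq, Real.coe_toNNReal _ hτ, add_sub_add_left_eq_sub, ← mul_sub,
      sub_sub_sub_cancel_left, abs_mul, abs_of_nonneg hτ, abs_sub_comm x y]
    exact mul_le_mul_of_nonneg_left h hτ

/-- Adding a tent over an interval on which a profile is close to its maximum raises the mass to
first order in the slope of the tent, and the energy only to order `p`. -/
theorem IsProfile.le_radialEnergy_sub_of_forall_lt {r0 r1 p l τ δ a : ℝ} {n : ℕ} {f : ℝ → ℝ}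
    (hf : IsProfile r0 r1 f) (hf1 : ∀ r, f r ≤ 1) (hp : 1 < p) (hr0 : 0 < r0) (hl0 : 0 ≤ l)
    (hl : ∀ g, IsProfile r0 r1 g → l * radialMass p n g ≤ radialEnergy p n g)
    (hτ : 0 < τ) (hδ : 0 < δ) (hη : τ * δ / 8 < 1)
    (ha : ∀ t ∈ Icc a (a + δ), 1 - τ * δ / 8 < f t) :
    l * (r0 ^ n * (τ * δ ^ 2 / 16)) ≤
      radialEnergy p n f - l * radialMass p n f + τ ^ p * r1 ^ n * δ := by
  have hp0 : 0 < p := by linarith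
  set q := 1 - τ * δ / 8 with hq
  set m := a + δ / 2 with hm
  set ψ : ℝ → ℝ := fun s => q + τ * (δ / 2 - |s - m|) with hψ
  have hψL : LipschitzWith (Real.toNNReal τ) ψ := lipschitzWith_tent q τ m (δ / 2) hτ.le
  set g : ℝ → ℝ := fun s => f s + max (max (ψ s - q) 0 - max (f s - q) 0) 0 with hg
  have hI : ∀ s, |s - m| ≤ δ / 2 → r0 < s ∧ s < r1 ∧ q < f s := fun s hs => by
    rw [abs_le] at hs
    have h := ha s ⟨by linarith [hs.1], by linarith [hs.2]⟩
    have hne : f s ≠ 0 := by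
      have : 0 < q := by linarith
      linarith
    exact ⟨(hf.mem_Ioo_of_ne_zero hne).1, (hf.mem_Ioo_of_ne_zero hne).2, h⟩
  have hfg : ∀ s, f s ≤ g s := fun s => le_add_of_nonneg_right (le_max_right _ _)
  have hge : ∀ s, |s - m| ≤ δ / 2 → ψ s ≤ g s := fun s hs => by
    have h1 : ψ s - q ≤ max (ψ s - q) 0 := le_max_left _ _
    have h2 : max (f s - q) 0 = f s - q := max_eq_left (by linarith [(hI s hs).2.2])
    have h3 := le_max_left (max (ψ s - q) 0 - max (f s - q) 0) 0
    simp only [hg]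
    linarith
  have hne : ∀ s, g s ≠ f s → |s - m| < δ / 2 ∧ g s = ψ s := fun s hs => by
    have hlt : 0 < max (ψ s - q) 0 - max (f s - q) 0 := by
      by_contra! h
      exact hs (by simp only [hg, max_eq_right h, add_zero])
    have h0 := le_max_right (f s - q) 0
    have h1 : 0 < ψ s - q := by
      by_contra! h
      rw [max_eq_right h] at hlt
      linarith
    have h2 : |s - m| < δ / 2 := by
      simp only [hψ, add_sub_cancel_left] at h1
      linarith [pos_of_mul_pos_right h1 hτ.le]
    refine ⟨h2, ?_⟩
    have h3 : max (f s - q) 0 = f s - q := max_eq_left (by linarith [(hI s h2.le).2.2])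
    simp only [hg]
    rw [max_eq_left hlt.le, h3, max_eq_left h1.le]
    ring
  have hout : ∀ s, ¬ |s - m| < δ / 2 → g s = f s := fun s hs => by
    by_contra h
    exact hs (hne s h).1
  have hgP : IsProfile r0 r1 g := by
    obtain ⟨C, hC⟩ := hf.lipschitz
    refine ⟨⟨_, hC.add ((((hψL.sub (LipschitzWith.const q)).max_const 0).sub
      ((hC.sub (LipschitzWith.const q)).max_const 0)).max_const 0)⟩,
      fun r => (hf.nonneg r).trans (hfg r), fun r hr => ?_⟩
    rw [hout r fun h => hr ⟨(hI r h.le).1, (hI r h.le).2.1⟩, hf.eq_zero r hr]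
  obtain ⟨C, hC⟩ := hf.lipschitz
  obtain ⟨D, hD⟩ := hgP.lipschitz
  have hE : radialEnergy p n g ≤ radialEnergy p n f + τ ^ p * r1 ^ n * δ := by
    rw [hgP.radialEnergy_eq_integral hp0 hr0, hf.radialEnergy_eq_integral hp0 hr0]
    have hii : Integrable ((Icc a (a + δ)).indicator fun _ => τ ^ p * r1 ^ n) :=
      (integrable_indicator_iff measurableSet_Icc).2 (integrableOn_const measure_Icc_lt_top.ne)
    have hcalc : τ ^ p * r1 ^ n * δ =
        ∫ r, (Icc a (a + δ)).indicator (fun _ => τ ^ p * r1 ^ n) r := by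
      rw [integral_indicator measurableSet_Icc, setIntegral_const, measureReal_def,
        Real.volume_Icc, ENNReal.toReal_ofReal (by linarith), smul_eq_mul]
      ring
    rw [hcalc, ← integral_add (hf.integrable_energy hp0 hr0.le) hii]
    refine integral_mono_ae (hgP.integrable_energy hp0 hr0.le)
      ((hf.integrable_energy hp0 hr0.le).add hii) ?_
    filter_upwards [hC.ae_differentiableAt_real, hD.ae_differentiableAt_real,
      hψL.ae_differentiableAt_real] with r hfr hgr hψr
    by_cases h : g r = f r
    · have hd : deriv f r = deriv g r := deriv_eq_of_eventually_le_of_eq hfr hgr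
        (Filter.Eventually.of_forall hfg) h.symm
      have : 0 ≤ (Icc a (a + δ)).indicator (fun _ => τ ^ p * r1 ^ n) r := by
        refine indicator_nonneg (fun s hs => ?_) r
        have := (hI s (abs_le.2 ⟨by linarith [hs.1], by linarith [hs.2]⟩))
        have : 0 < r1 := by linarith
        positivity
      rw [hd]
      linarith
    · obtain ⟨h1, h2⟩ := hne r h
      have hd : deriv ψ r = deriv g r := by
        refine deriv_eq_of_eventually_le_of_eq hψr hgr ?_ h2.symm
        have : ball m (δ / 2) ∈ nhds r := isOpen_ball.mem_nhds (by rwa [mem_ball, Real.dist_eq])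
        filter_upwards [this] with s hs
        rw [mem_ball, Real.dist_eq] at hs
        exact hge s hs.le
      have hle : |deriv g r| ≤ τ := by
        rw [← hd]
        simpa [hτ.le] using norm_deriv_le_of_lipschitz hψL (x₀ := r)
      have hr := hI r h1.le
      have hr' : 0 ≤ r := hr0.le.trans hr.1.le
      have hmem : r ∈ Icc a (a + δ) := by
        rw [abs_lt] at h1
        exact ⟨by linarith [h1.1], by linarith [h1.2]⟩
      rw [indicator_of_mem hmem]
      have h3 : r ^ n * |deriv g r| ^ p ≤ τ ^ p * r1 ^ n := by
        rw [mul_comm]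
        have := hr.2.1.le
        gcongr
      have := hf.energy_density_nonneg (n := n) hp0 hr0.le r
      linarith
  have hM : radialMass p n f + r0 ^ n * (τ * δ ^ 2 / 16) ≤ radialMass p n g := by
    rw [hgP.radialMass_eq_integral hp0 hr0, hf.radialMass_eq_integral hp0 hr0]
    set J := Icc (m - δ / 4) (m + δ / 4) with hJ
    have hii : Integrable (J.indicator fun _ => r0 ^ n * (τ * δ / 8)) :=
      (integrable_indicator_iff measurableSet_Icc).2 (integrableOn_const measure_Icc_lt_top.ne)
    have hcalc : r0 ^ n * (τ * δ ^ 2 / 16) =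
        ∫ r, J.indicator (fun _ => r0 ^ n * (τ * δ / 8)) r := by
      rw [integral_indicator measurableSet_Icc, setIntegral_const, measureReal_def,
        Real.volume_Icc, ENNReal.toReal_ofReal (by linarith), smul_eq_mul]
      ring
    rw [hcalc, ← integral_add (hf.integrable_mass hp0 hr0.le) hii]
    refine integral_mono ((hf.integrable_mass hp0 hr0.le).add hii)
      (hgP.integrable_mass hp0 hr0.le) fun r => ?_
    have hmono : |f r| ^ p ≤ |g r| ^ p := by
      rw [abs_of_nonneg (hf.nonneg r), abs_of_nonneg (hgP.nonneg r)]
      exact Real.rpow_le_rpow (hf.nonneg r) (hfg r) hp0.le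
    by_cases hr : r ∈ J
    · have h1 : |r - m| ≤ δ / 4 := abs_le.2 ⟨by linarith [hr.1], by linarith [hr.2]⟩
      have h2 := hI r (by linarith)
      have h3 : 1 + τ * δ / 8 ≤ g r := by
        refine le_trans ?_ (hge r (by linarith))
        have : τ * (δ / 4) ≤ τ * (δ / 2 - |r - m|) := by gcongr; linarith
        simp only [hψ, hq]
        linarith
      have hτδ : 0 < τ * δ / 8 := by positivity
      have h4 : 1 + τ * δ / 8 ≤ |g r| ^ p := by
        rw [abs_of_nonneg (hgP.nonneg r)]
        exact h3.trans (Real.self_le_rpow_of_one_le (by linarith) hp.le)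
      have h5 : |f r| ^ p ≤ 1 := Real.rpow_le_one (abs_nonneg _)
        (by rw [abs_of_nonneg (hf.nonneg r)]; exact hf1 r) hp0.le
      have h6 : r0 ^ n ≤ r ^ n := pow_le_pow_left₀ hr0.le h2.1.le n
      have h7 : 0 < r0 ^ n := by positivity
      simp only [indicator_of_mem hr]
      calc r ^ n * |f r| ^ p + r0 ^ n * (τ * δ / 8)
          ≤ r ^ n * |f r| ^ p + r ^ n * (τ * δ / 8) := by gcongr
        _ = r ^ n * (|f r| ^ p + τ * δ / 8) := by ring
        _ ≤ r ^ n * |g r| ^ p := by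
          have := h7.le.trans h6
          gcongr
          linarith
    · simp only [indicator_of_notMem hr, add_zero]
      by_cases hr' : r ∈ Ioo r0 r1
      · have := hr0.le.trans hr'.1.le
        gcongr
      · simp [hf.eq_zero r hr', hgP.eq_zero r hr', hp0.ne']
  have h1 := hl g hgP
  have h2 := mul_le_mul_of_nonneg_left hM hl0
  linarith

/-- An almost optimal profile cannot stay close to its maximum on an interval of given length. -/
theorem exists_forall_exists_le_one_sub {r0 r1 p l δ : ℝ} {n : ℕ} (hp : 1 < p) (hr0 : 0 < r0)
    (hr01 : r0 < r1) (hl0 : 0 < l)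
    (hl : ∀ g, IsProfile r0 r1 g → l * radialMass p n g ≤ radialEnergy p n g) (hδ : 0 < δ) :
    ∃ η ε : ℝ, 0 < η ∧ η < 1 ∧ 0 < ε ∧ ∀ f, IsProfile r0 r1 f → (∀ r, f r ≤ 1) →
      radialEnergy p n f < l * radialMass p n f + ε → ∀ a, ∃ t ∈ Icc a (a + δ), f t ≤ 1 - η := by
  have hr1 : 0 < r1 := hr0.trans hr01
  set A : ℝ := l * r0 ^ n * δ / (32 * r1 ^ n) with hA
  have hA0 : 0 < A := by positivity
  set τ : ℝ := min (A ^ (p - 1)⁻¹) (4 / δ) with hτ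
  have hτ0 : 0 < τ := lt_min (by positivity) (by positivity)
  have hτδ : τ * δ ≤ 4 := by
    have : τ ≤ 4 / δ := min_le_right _ _
    rwa [le_div_iff₀ hδ] at this
  have hp1 : 0 < p - 1 := by linarith
  have hτA : τ ^ (p - 1) ≤ A := by
    calc τ ^ (p - 1) ≤ (A ^ (p - 1)⁻¹) ^ (p - 1) :=
          Real.rpow_le_rpow hτ0.le (min_le_left _ _) hp1.le
      _ = A := by rw [← Real.rpow_mul hA0.le, inv_mul_cancel₀ hp1.ne', Real.rpow_one]
  refine ⟨τ * δ / 8, l * (r0 ^ n * (τ * δ ^ 2 / 32)), by positivity, by linarith, by positivity,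
    fun f hf hf1 hE a => ?_⟩
  by_contra! h
  have h1 := hf.le_radialEnergy_sub_of_forall_lt hf1 hp hr0 hl0.le hl hτ0 hδ (by linarith) h
  have h2 : τ ^ p * r1 ^ n * δ ≤ l * (r0 ^ n * (τ * δ ^ 2 / 32)) := by
    have h3 : τ ^ p = τ ^ (p - 1) * τ := by
      rw [← Real.rpow_add_one hτ0.ne']
      ring_nf
    calc τ ^ p * r1 ^ n * δ ≤ A * τ * r1 ^ n * δ := by
          rw [h3]
          gcongr
      _ = _ := by
          rw [hA]
          field_simp
  have h4 : l * (r0 ^ n * (τ * δ ^ 2 / 16)) =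
    l * (r0 ^ n * (τ * δ ^ 2 / 32)) + l * (r0 ^ n * (τ * δ ^ 2 / 32)) := by ring
  linarith

theorem pLambda1_nonneg (p : ℝ) {N : ℕ} (U : Set (EuclideanSpace ℝ (Fin N))) :
    0 ≤ pLambda1 p U := by
  refine Real.sInf_nonneg ?_
  rintro _ ⟨φ, -, -, rfl⟩
  exact div_nonneg (integral_nonneg fun _ => by positivity) (integral_nonneg fun _ => by positivity)

theorem exists_norm_eq_of_two_le {N : ℕ} (hN : 2 ≤ N) (t : ℝ) (ht : 0 ≤ t) :
    ∃ x : EuclideanSpace ℝ (Fin N), ‖x‖ = t := by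
  refine ⟨t • e1v hN, ?_⟩
  rw [norm_smul, e1v, PiLp.norm_single, norm_one, mul_one, Real.norm_of_nonneg ht]

theorem exists_isTestFun_ne_zero {N : ℕ} {U : Set (EuclideanSpace ℝ (Fin N))} (hU : IsOpen U)
    (hne : U.Nonempty) : ∃ φ, IsTestFun U φ ∧ φ ≠ 0 := by
  obtain ⟨x, hx⟩ := hne
  obtain ⟨f, h1, h2, h3, -, h5⟩ := exists_contDiff_tsupport_subset (n := (⊤ : ℕ∞)) (hU.mem_nhds hx)
  exact ⟨f, ⟨h3, h2, h1⟩, fun h => by simp [h] at h5⟩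

theorem IsTestFun.integral_pos {N : ℕ} {U : Set (EuclideanSpace ℝ (Fin N))}
    {φ : EuclideanSpace ℝ (Fin N) → ℝ} (hφ : IsTestFun U φ) (h0 : φ ≠ 0) {p : ℝ} (hp : 0 < p) :
    0 < ∫ x, |φ x| ^ p := by
  obtain ⟨x, hx⟩ := Function.ne_iff.1 h0
  have hx' : 0 < |φ x| := abs_pos.2 hx
  refine Continuous.integral_pos_of_hasCompactSupport_nonneg_nonzero (x := x)
    (hφ.1.continuous.abs.rpow_const fun _ => Or.inr hp.le) (hφ.2.1.mono fun y hy => ?_)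
    (fun _ => by positivity) (by positivity)
  rw [Function.mem_support] at hy ⊢
  contrapose! hy
  simp [hy, hp.ne']

theorem radialLambda_le_pLambda1 {N : ℕ} (hN : 2 ≤ N) {p r0 r1 : ℝ} (hp : 1 < p) (hr0 : 0 < r0)
    (hr01 : r0 < r1) : radialLambda p (N - 1) r0 r1 ≤
      pLambda1 p (ball (0 : EuclideanSpace ℝ (Fin N)) r1 \ closure (ball 0 r0)) := by
  have hp0 : 0 < p := by linarith
  refine le_csInf ?_ ?_
  · obtain ⟨x, hx⟩ := exists_norm_eq_of_two_le hN ((r0 + r1) / 2) (by linarith)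
    obtain ⟨φ, h1, h2⟩ := exists_isTestFun_ne_zero
      (U := ball (0 : EuclideanSpace ℝ (Fin N)) r1 \ closure (ball 0 r0))
      (isOpen_ball.sdiff isClosed_closure)
      ⟨x, by rw [mem_ball_zero_iff]; linarith, fun h => by
        have := closure_ball_subset_closedBall h
        rw [mem_closedBall_zero_iff] at this
        linarith⟩
    exact ⟨_, φ, h1, h2, rfl⟩
  · rintro _ ⟨φ, hφ, h0, rfl⟩
    obtain ⟨h1, h2⟩ := setIntegral_rayleigh_eq hp0 hφ
    rw [h1, h2, le_div_iff₀ (hφ.integral_pos h0 hp0)]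
    exact mul_integral_le_of_forall_profile hN hp0 hr0
      (fun f hf => radialLambda_mul_le hp hr0 hf) hφ

theorem exists_norm_sub_eq_norm_eq {N : ℕ} (hN : 2 ≤ N) {c : EuclideanSpace ℝ (Fin N)}
    (hc : 0 < ‖c‖) {s t : ℝ} (hs : 0 ≤ s) (h1 : |‖c‖ - s| ≤ t) (h2 : t ≤ ‖c‖ + s) :
    ∃ x : EuclideanSpace ℝ (Fin N), ‖x - c‖ = s ∧ ‖x‖ = t := by
  have hrank : 1 < Module.rank ℝ (EuclideanSpace ℝ (Fin N)) := by
    rw [← Module.finrank_eq_rank, finrank_euclideanSpace_fin]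
    exact_mod_cast hN
  have hpre : IsPreconnected (sphere c s) := isPreconnected_sphere hrank c s
  have hmem : ∀ σ : ℝ, |σ| = 1 → c + (σ * s / ‖c‖) • c ∈ sphere c s := fun σ hσ => by
    rw [mem_sphere_iff_norm, add_sub_cancel_left, norm_smul, Real.norm_eq_abs, abs_div, abs_mul, hσ,
      abs_of_nonneg hs, abs_of_pos hc]
    field_simp
  have hval : ∀ σ : ℝ, ‖c + (σ * s / ‖c‖) • c‖ = |‖c‖ + σ * s| := fun σ => by
    have : c + (σ * s / ‖c‖) • c = (1 + σ * s / ‖c‖) • c := by rw [add_smul, one_smul]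
    rw [this, norm_smul, Real.norm_eq_abs, ← abs_of_pos hc, ← abs_mul, abs_of_pos hc]
    congr 1
    field_simp
  have := hpre.intermediate_value (hmem (-1) (by simp)) (hmem 1 (by simp))
    (f := fun x => ‖x‖) continuous_norm.continuousOn
  have ht : t ∈ Icc ‖c + (-1 * s / ‖c‖) • c‖ ‖c + (1 * s / ‖c‖) • c‖ := by
    rw [hval, hval]
    refine ⟨?_, ?_⟩
    · rwa [neg_one_mul, ← sub_eq_add_neg]
    · rwa [one_mul, abs_of_nonneg (by positivity)]
  obtain ⟨x, hx, hxt⟩ := this ht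
  exact ⟨x, mem_sphere_iff_norm.1 hx, hxt⟩

theorem exists_uniform_modulus {r0 r1 p E η : ℝ} {n : ℕ} (hp : 1 < p) (hr0 : 0 < r0) (hE : 0 < E)
    (hη : 0 < η) : ∃ κ > 0, ∀ f, IsProfile r0 r1 f → radialEnergy p n f ≤ E →
      ∀ a b, |b - a| < κ → |f b - f a| ≤ η := by
  have hp1 : 0 < p - 1 := by linarith
  set X : ℝ := 2 * (r0 ^ n)⁻¹ * E / η with hX
  have hX0 : 0 < X := by positivity
  set L : ℝ := X ^ (p - 1)⁻¹ with hL
  have hL0 : 0 < L := by positivity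
  have hLX : L ^ (p - 1) = X := by
    rw [hL, ← Real.rpow_mul hX0.le, inv_mul_cancel₀ hp1.ne', Real.rpow_one]
  refine ⟨η / (2 * L), by positivity, fun f hf hfE a b hab => ?_⟩
  refine (hf.abs_sub_le (n := n) hp hr0 hL0 a b).trans ?_
  have h1 : L * |b - a| ≤ η / 2 := by
    calc L * |b - a| ≤ L * (η / (2 * L)) := by gcongr
      _ = η / 2 := by field_simp
  have h2 : (L ^ (p - 1))⁻¹ * (r0 ^ n)⁻¹ * radialEnergy p n f ≤ η / 2 := by
    calc (L ^ (p - 1))⁻¹ * (r0 ^ n)⁻¹ * radialEnergy p n f ≤ X⁻¹ * (r0 ^ n)⁻¹ * E := by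
          rw [hLX]
          gcongr
      _ = η / 2 := by
          rw [hX]
          field_simp
  linarith

theorem deriv_comp_min_max_of_lt {f : ℝ → ℝ} {ρ r : ℝ} (hr : r < ρ) :
    deriv (fun s => f (min s ρ)) r = deriv f r ∧ deriv (fun s => f (max s ρ)) r = 0 := by
  have h : Iio ρ ∈ nhds r := Iio_mem_nhds hr
  constructor
  · refine Filter.EventuallyEq.deriv_eq ?_
    filter_upwards [h] with s hs
    rw [min_eq_left (le_of_lt hs)]
  · rw [← deriv_const r (f ρ)]
    refine Filter.EventuallyEq.deriv_eq ?_
    filter_upwards [h] with s hs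
    rw [max_eq_right (le_of_lt hs)]

theorem deriv_comp_min_max_of_gt {f : ℝ → ℝ} {ρ r : ℝ} (hr : ρ < r) :
    deriv (fun s => f (min s ρ)) r = 0 ∧ deriv (fun s => f (max s ρ)) r = deriv f r := by
  have h : Ioi ρ ∈ nhds r := Ioi_mem_nhds hr
  constructor
  · rw [← deriv_const r (f ρ)]
    refine Filter.EventuallyEq.deriv_eq ?_
    filter_upwards [h] with s hs
    rw [min_eq_right (le_of_lt hs)]
  · refine Filter.EventuallyEq.deriv_eq ?_
    filter_upwards [h] with s hs
    rw [max_eq_left (le_of_lt hs)]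

theorem rpow_min_eq (a b p : ℝ) :
    min a b ^ p = a ^ p + b ^ p - max a b ^ p := by
  rcases le_total a b with h | h
  · rw [min_eq_left h, max_eq_right h]
    ring
  · rw [min_eq_right h, max_eq_left h]
    ring

/-- The Rayleigh quotient of the function obtained by rearranging a profile with maximum at `ρ`:
its increasing part is used around `c` and its decreasing part around `0`. -/
theorem pLambda1_mul_le_of_isProfile {N : ℕ} (hN : 2 ≤ N) {p r0 r1 ρ θ κ : ℝ} (hp : 1 < p)
    (hr0 : 0 < r0) {f : ℝ → ℝ} (hf : IsProfile r0 r1 f) (hf1 : ∀ r, f r ≤ 1)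
    (hρ : f ρ = 1) {c x₀ : EuclideanSpace ℝ (Fin N)}
    (hB : ∀ x ∈ ball x₀ κ, ‖x - c‖ ≤ ρ ∧ ρ ≤ ‖x‖ ∧ f ‖x - c‖ ≤ θ ∧ f ‖x‖ ≤ θ) :
    pLambda1 p (ball (0 : EuclideanSpace ℝ (Fin N)) r1 \ closure (ball c r0)) *
      (sphereArea N * radialMass p (N - 1) f + (1 - θ ^ p) * volume.real (ball x₀ κ)) ≤
      sphereArea N * radialEnergy p (N - 1) f := by
  have hp0 : 0 < p := by linarith
  obtain ⟨C, hC⟩ := hf.lipschitz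
  have hρI := hf.mem_Ioo_of_ne_zero (r := ρ) (by simp [hρ])
  have hnt : Nontrivial (EuclideanSpace ℝ (Fin N)) :=
    Module.nontrivial_of_finrank_pos (R := ℝ) (by rw [finrank_euclideanSpace_fin]; omega)
  set Ω := ball (0 : EuclideanSpace ℝ (Fin N)) r1 \ closure (ball c r0) with hΩ
  set F₁ : ℝ → ℝ := fun s => f (min s ρ) with hF₁
  set F₂ : ℝ → ℝ := fun s => f (max s ρ) with hF₂
  set w₁ : EuclideanSpace ℝ (Fin N) → ℝ := fun x => F₁ ‖x - c‖ with hw₁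
  set w₂ : EuclideanSpace ℝ (Fin N) → ℝ := fun x => F₂ ‖x - 0‖ with hw₂
  have hF₁L : LipschitzWith C F₁ := (hC.comp (LipschitzWith.id.min_const ρ)).weaken (by simp)
  have hF₂L : LipschitzWith C F₂ := (hC.comp (LipschitzWith.id.max_const ρ)).weaken (by simp)
  have hnorm : ∀ z : EuclideanSpace ℝ (Fin N), LipschitzWith 1 fun x => ‖x - z‖ := fun z =>
    (lipschitzWith_one_norm.comp (LipschitzWith.id.sub (LipschitzWith.const z))).weaken (by simp)
  have hw₁L : LipschitzWith C w₁ := (hF₁L.comp (hnorm c)).weaken (by simp)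
  have hw₂L : LipschitzWith C w₂ := (hF₂L.comp (hnorm 0)).weaken (by simp)
  have hw₁0 : ∀ x, 0 ≤ w₁ x := fun x => hf.nonneg _
  have hw₂0 : ∀ x, 0 ≤ w₂ x := fun x => hf.nonneg _
  set u : EuclideanSpace ℝ (Fin N) → ℝ := fun x => min (w₁ x) (w₂ x) with hu
  have huL : LipschitzWith C u := by simpa using hw₁L.min hw₂L
  have hu0 : ∀ x, 0 ≤ u x := fun x => le_min (hw₁0 x) (hw₂0 x)
  have hw₂z : ∀ x, x ∉ ball (0 : EuclideanSpace ℝ (Fin N)) r1 → w₂ x = 0 := fun x hx => by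
    rw [mem_ball_zero_iff, not_lt] at hx
    refine hf.eq_zero _ fun h => ?_
    have := (le_max_left ‖x - 0‖ ρ).trans_lt h.2
    rw [sub_zero] at this
    linarith
  have huz : ∀ x, x ∉ Ω → u x = 0 := fun x hx => by
    by_cases h1 : x ∈ ball (0 : EuclideanSpace ℝ (Fin N)) r1
    · have h2 : x ∈ closedBall c r0 := closure_ball_subset_closedBall (by
        by_contra h
        exact hx ⟨h1, h⟩)
      rw [mem_closedBall_iff_norm] at h2
      have h3 : w₁ x = 0 := hf.eq_zero _ fun h => by
        have := h.1.trans_le (min_le_left ‖x - c‖ ρ)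
        linarith
      simp only [hu, h3]
      exact min_eq_left (hw₂0 x)
    · simp only [hu, hw₂z x h1]
      exact min_eq_right (hw₁0 x)
  have hΩo : IsOpen Ω := isOpen_ball.sdiff isClosed_closure
  have hΩb : Bornology.IsBounded Ω := isBounded_ball.subset sdiff_subset
  have hray := pLambda1_mul_le_of_lipschitz hp0 hΩo hΩb huL hu0 huz
  have henergy : ∫ x, ‖fderiv ℝ u x‖ ^ p ≤ sphereArea N * radialEnergy p (N - 1) f := by
    have hi₁ : Integrable fun x : EuclideanSpace ℝ (Fin N) => |deriv F₁ ‖x - c‖| ^ p := by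
      refine integrable_of_bounded_of_eq_zero_off (M := (C : ℝ) ^ p) (K := closedBall c ρ)
        ?_ (fun x => ?_) isBounded_closedBall fun x hx => ?_
      · exact (((measurable_deriv F₁).comp (by fun_prop)).abs.pow_const p).aestronglyMeasurable
      · rw [Real.norm_of_nonneg (by positivity)]
        exact Real.rpow_le_rpow (abs_nonneg _) (norm_deriv_le_of_lipschitz hF₁L) hp0.le
      · rw [mem_closedBall_iff_norm, not_le] at hx
        rw [(deriv_comp_min_max_of_gt hx).1, abs_zero, Real.zero_rpow hp0.ne']
    have hi₂ : Integrable fun x : EuclideanSpace ℝ (Fin N) => |deriv F₂ ‖x - 0‖| ^ p := by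
      refine integrable_of_bounded_of_eq_zero_off (M := (C : ℝ) ^ p) (K := closedBall 0 r1)
        ?_ (fun x => ?_) isBounded_closedBall fun x hx => ?_
      · exact (((measurable_deriv F₂).comp (by fun_prop)).abs.pow_const p).aestronglyMeasurable
      · rw [Real.norm_of_nonneg (by positivity)]
        exact Real.rpow_le_rpow (abs_nonneg _) (norm_deriv_le_of_lipschitz hF₂L) hp0.le
      · rw [mem_closedBall_iff_norm, not_le] at hx
        rw [(deriv_comp_min_max_of_gt (hρI.2.trans hx)).2, hf.deriv_eq_zero fun h => h.2.not_gt hx,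
          abs_zero, Real.zero_rpow hp0.ne']
    have hj₁ : Integrable fun r : ℝ => r ^ (N - 1) * |deriv F₁ r| ^ p :=
      integrable_pow_mul_abs_rpow (a := 0) (b := ρ) (M := C) hp0 le_rfl (measurable_deriv F₁)
        (fun r => norm_deriv_le_of_lipschitz hF₁L) fun r hr => by
          rcases lt_or_ge ρ r with h | h
          · exact (deriv_comp_min_max_of_gt h).1
          · have h0 : r < 0 := by
              by_contra! h'
              exact hr ⟨h', h⟩
            rw [(deriv_comp_min_max_of_lt (by linarith [hρI.1])).1]
            exact hf.deriv_eq_zero fun h' => by linarith [h'.1]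
    have hj₂ : Integrable fun r : ℝ => r ^ (N - 1) * |deriv F₂ r| ^ p :=
      integrable_pow_mul_abs_rpow (a := 0) (b := r1) (M := C) hp0 le_rfl (measurable_deriv F₂)
        (fun r => norm_deriv_le_of_lipschitz hF₂L) fun r hr => by
          rcases lt_or_ge r1 r with h | h
          · rw [(deriv_comp_min_max_of_gt (hρI.2.trans h)).2]
            exact hf.deriv_eq_zero fun h' => by linarith [h'.2]
          · have h0 : r < 0 := by
              by_contra! h'
              exact hr ⟨h', h⟩
            exact (deriv_comp_min_max_of_lt (by linarith [hρI.1])).2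
    calc ∫ x, ‖fderiv ℝ u x‖ ^ p
        ≤ ∫ x, (|deriv F₁ ‖x - c‖| ^ p + |deriv F₂ ‖x - 0‖| ^ p) := by
          refine integral_mono_ae (integrable_norm_fderiv_rpow hp0 huL hΩb huz) (hi₁.add hi₂) ?_
          have hne : ∀ z : EuclideanSpace ℝ (Fin N), ∀ᵐ x, x ≠ z := fun z =>
            compl_mem_ae_iff.2 (measure_singleton z)
          filter_upwards [huL.ae_differentiableAt, hw₁L.ae_differentiableAt,
            hw₂L.ae_differentiableAt, hne c, hne 0] with x hdu hd₁ hd₂ hxc hx0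
          have hp₁ : 0 ≤ |deriv F₁ ‖x - c‖| ^ p := by positivity
          have hp₂ : 0 ≤ |deriv F₂ ‖x - 0‖| ^ p := by positivity
          rcases le_total (w₁ x) (w₂ x) with h | h
          · rw [fderiv_eq_of_eventually_le_of_eq hdu hd₁
              (Filter.Eventually.of_forall fun y => min_le_left _ _) (min_eq_left h)]
            have := Real.rpow_le_rpow (norm_nonneg _) (norm_fderiv_comp_norm_sub_le hxc hd₁) hp0.le
            linarith
          · rw [fderiv_eq_of_eventually_le_of_eq hdu hd₂
              (Filter.Eventually.of_forall fun y => min_le_right _ _) (min_eq_right h)]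
            have := Real.rpow_le_rpow (norm_nonneg _) (norm_fderiv_comp_norm_sub_le hx0 hd₂) hp0.le
            linarith
      _ = sphereArea N * (∫ r in Ioi (0 : ℝ), r ^ (N - 1) * |deriv F₁ r| ^ p) +
          sphereArea N * ∫ r in Ioi (0 : ℝ), r ^ (N - 1) * |deriv F₂ r| ^ p := by
          rw [integral_add hi₁ hi₂, integral_comp_norm_sub hN (fun r => |deriv F₁ r| ^ p) c,
            integral_comp_norm_sub hN (fun r => |deriv F₂ r| ^ p) 0]
      _ = sphereArea N * radialEnergy p (N - 1) f := by
          rw [← mul_add, ← integral_add hj₁.integrableOn hj₂.integrableOn, radialEnergy]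
          congr 1
          refine setIntegral_congr_ae measurableSet_Ioi ?_
          have hne : ∀ᵐ r : ℝ, r ≠ ρ := compl_mem_ae_iff.2 (measure_singleton ρ)
          filter_upwards [hne] with r hr _
          rcases lt_or_gt_of_ne hr with h | h
          · rw [(deriv_comp_min_max_of_lt h).1, (deriv_comp_min_max_of_lt h).2, abs_zero,
              Real.zero_rpow hp0.ne', mul_zero, add_zero]
          · rw [(deriv_comp_min_max_of_gt h).1, (deriv_comp_min_max_of_gt h).2, abs_zero,
              Real.zero_rpow hp0.ne', mul_zero, zero_add]
  have hmass : sphereArea N * radialMass p (N - 1) f + (1 - θ ^ p) * volume.real (ball x₀ κ) ≤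
      ∫ x, |u x| ^ p := by
    have hc₁ : Continuous fun r => r ^ (N - 1) * (1 - |F₁ r| ^ p) :=
      (continuous_pow _).mul (continuous_const.sub
        (hF₁L.continuous.abs.rpow_const fun _ => Or.inr hp0.le))
    have hc₂ : Continuous fun r => r ^ (N - 1) * |F₂ r| ^ p :=
      (continuous_pow _).mul (hF₂L.continuous.abs.rpow_const fun _ => Or.inr hp0.le)
    have hF₁ρ : ∀ r, ρ ≤ r → F₁ r = 1 := fun r hr => by simp only [hF₁, min_eq_right hr, hρ]
    have hF₂ρ : ∀ r, r ≤ ρ → F₂ r = 1 := fun r hr => by simp only [hF₂, max_eq_right hr, hρ]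
    have hj₁ : IntegrableOn (fun r => r ^ (N - 1) * (1 - |F₁ r| ^ p)) (Ioi 0) :=
      (hc₁.integrableOn_Icc (a := 0) (b := ρ)).of_forall_sdiff_eq_zero measurableSet_Ioi
        fun r hr => by
          have : ρ ≤ r := by
            by_contra! h
            exact hr.2 ⟨le_of_lt hr.1, h.le⟩
          simp [hF₁ρ r this]
    have hj₂ : IntegrableOn (fun r => r ^ (N - 1) * |F₂ r| ^ p) (Ioi 0) :=
      (hc₂.integrableOn_Icc (a := 0) (b := r1)).of_forall_sdiff_eq_zero measurableSet_Ioi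
        fun r hr => by
          have h1 : r1 < r := by
            by_contra! h
            exact hr.2 ⟨le_of_lt hr.1, h⟩
          have h2 : F₂ r = 0 := by
            simp only [hF₂, max_eq_left (hρI.2.trans h1).le]
            exact hf.eq_zero r fun h => by linarith [h.2]
          simp [h2, hp0.ne']
    have hi₁ : Integrable fun x => 1 - |w₁ x| ^ p := by
      refine integrable_of_bounded_of_eq_zero_off (M := 1) (K := closedBall c ρ) ?_ (fun x => ?_)
        isBounded_closedBall fun x hx => ?_
      · exact (continuous_const.sub
          (hw₁L.continuous.abs.rpow_const fun _ => Or.inr hp0.le)).aestronglyMeasurable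
      · have h1 : |w₁ x| ^ p ≤ 1 := Real.rpow_le_one (abs_nonneg _)
          (by rw [abs_of_nonneg (hw₁0 x)]; exact hf1 _) hp0.le
        have h2 : 0 ≤ |w₁ x| ^ p := by positivity
        rw [Real.norm_of_nonneg (by linarith)]
        linarith
      · rw [mem_closedBall_iff_norm, not_le] at hx
        simp [hw₁, hF₁ρ _ hx.le]
    have hi₂ : Integrable fun x => |w₂ x| ^ p :=
      integrable_abs_rpow_of_lipschitz hp0 hw₂L.continuous isBounded_ball hw₂z
    have hi₂₁ : Integrable fun x => |w₂ x| ^ p - (1 - |w₁ x| ^ p) := hi₂.sub hi₁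
    have hi₃ : Integrable ((ball x₀ κ).indicator fun _ => 1 - θ ^ p) :=
      (integrable_indicator_iff measurableSet_ball).2 (integrableOn_const measure_ball_lt_top.ne)
    calc sphereArea N * radialMass p (N - 1) f + (1 - θ ^ p) * volume.real (ball x₀ κ)
        = (sphereArea N * (∫ r in Ioi (0 : ℝ), r ^ (N - 1) * |F₂ r| ^ p) -
          sphereArea N * ∫ r in Ioi (0 : ℝ), r ^ (N - 1) * (1 - |F₁ r| ^ p)) +
          (1 - θ ^ p) * volume.real (ball x₀ κ) := by
          rw [← mul_sub, ← integral_sub hj₂ hj₁, radialMass]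
          congr 2
          refine setIntegral_congr_fun measurableSet_Ioi fun r _ => ?_
          rcases le_total r ρ with h | h
          · simp only [hF₂ρ r h, abs_one, Real.one_rpow, hF₁, min_eq_left h]
            ring
          · simp only [hF₁ρ r h, abs_one, Real.one_rpow, hF₂, max_eq_left h]
            ring
      _ = ∫ x, (|w₂ x| ^ p - (1 - |w₁ x| ^ p) + (ball x₀ κ).indicator (fun _ => 1 - θ ^ p) x) := by
          rw [integral_add hi₂₁ hi₃, integral_sub hi₂ hi₁,
            integral_comp_norm_sub hN (fun r => |F₂ r| ^ p) 0,
            integral_comp_norm_sub hN (fun r => 1 - |F₁ r| ^ p) c,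
            integral_indicator measurableSet_ball, setIntegral_const, smul_eq_mul, mul_comm (1 - _)]
      _ ≤ ∫ x, |u x| ^ p := by
          refine integral_mono (hi₂₁.add hi₃)
            (integrable_abs_rpow_of_lipschitz hp0 huL.continuous hΩb huz) fun x => ?_
          have h1 : |u x| ^ p = w₁ x ^ p + w₂ x ^ p - max (w₁ x) (w₂ x) ^ p := by
            rw [abs_of_nonneg (hu0 x)]
            exact rpow_min_eq _ _ _
          simp only [h1, abs_of_nonneg (hw₁0 x), abs_of_nonneg (hw₂0 x)]
          have h0 : 0 ≤ max (w₁ x) (w₂ x) := (hw₁0 x).trans (le_max_left _ _)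
          by_cases hx : x ∈ ball x₀ κ
          · obtain ⟨h2, h3, h4, h5⟩ := hB x hx
            have h6 : max (w₁ x) (w₂ x) ≤ θ := by
              simp only [hw₁, hw₂, hF₁, hF₂, sub_zero, min_eq_left h2, max_eq_left h3]
              exact max_le h4 h5
            have := Real.rpow_le_rpow h0 h6 hp0.le
            rw [indicator_of_mem hx]
            linarith
          · have := Real.rpow_le_one h0 (max_le (hf1 _) (hf1 _)) hp0.le
            rw [indicator_of_notMem hx]
            linarith
  exact (mul_le_mul_of_nonneg_left hmass (pLambda1_nonneg p Ω)).trans (hray.trans henergy)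

/-- Among all placements of a ball of radius `r0` inside `B(0,r1)`, the first Dirichlet
eigenvalue of the `p`-Laplacian on the complement is strictly maximal exactly in the
concentric configuration. -/
theorem pLambda1_lt_of_not_concentric
    (N : ℕ) (hN : 2 ≤ N) (p : ℝ) (hp : 1 < p) (r0 r1 : ℝ)
    (hr0 : 0 < r0) (hr01 : r0 < r1) (c : EuclideanSpace ℝ (Fin N))
    (hc0 : 0 < ‖c‖) (hc1 : ‖c‖ < r1 - r0) :
    pLambda1 p
        (Metric.ball (0 : EuclideanSpace ℝ (Fin N)) r1 \ closure (Metric.ball c r0)) <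
      pLambda1 p
        (Metric.ball (0 : EuclideanSpace ℝ (Fin N)) r1 \ closure (Metric.ball 0 r0)) := by
  refine lt_of_lt_of_le ?_ (radialLambda_le_pLambda1 hN hp hr0 hr01)
  have hp0 : 0 < p := by linarith
  have hd : 0 < r1 - r0 := sub_pos.2 hr01
  have hr1 : 0 < r1 := hr0.trans hr01
  set n := N - 1 with hn
  set l := radialLambda p n r0 r1 with hl
  have hl0 : 0 < l := radialLambda_pos hp hr0 hr01
  have hS : 0 < sphereArea N := sphereArea_pos hN
  set δ : ℝ := min (‖c‖ / 2) (r0 / 2) with hδ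
  have hδ0 : 0 < δ := lt_min (by positivity) (by positivity)
  have hδc : δ ≤ ‖c‖ / 2 := min_le_left _ _
  have hδr : δ ≤ r0 / 2 := min_le_right _ _
  obtain ⟨η, ε, hη0, hη1, hε0, hbump⟩ := exists_forall_exists_le_one_sub (n := n) hp hr0 hr01 hl0
    (fun g hg => radialLambda_mul_le hp hr0 hg) hδ0
  set E : ℝ := l * (r1 ^ n * (r1 - r0)) + ε with hE
  have hE0 : 0 < E := by positivity
  obtain ⟨κ, hκ0, hmod⟩ := exists_uniform_modulus (r1 := r1) (n := n) hp hr0 hE0 (half_pos hη0)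
  set θ : ℝ := 1 - η / 2 with hθ
  have hθp : θ ^ p < 1 := Real.rpow_lt_one (by linarith) (by linarith) hp0
  set V : ℝ := volume.real (ball (0 : EuclideanSpace ℝ (Fin N)) κ) with hV
  have hV0 : 0 < V := ENNReal.toReal_pos (measure_ball_pos _ _ hκ0).ne' measure_ball_lt_top.ne
  set G : ℝ := (1 - θ ^ p) * V with hG
  have hG0 : 0 < G := mul_pos (by linarith) hV0
  obtain ⟨f, ρ, hf, hf1, hρ, hfE⟩ := exists_isProfile_radialEnergy_lt (n := n) hp hr0 hr01
    (ε := min ε (l * G / sphereArea N)) (lt_min hε0 (by positivity))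
  have hm0 := hf.radialMass_pos (n := n) hp0 hr0 (ρ := ρ) (by simp [hρ])
  have hρI := hf.mem_Ioo_of_ne_zero (r := ρ) (by simp [hρ])
  have hfε : radialEnergy p n f < l * radialMass p n f + ε :=
    hfE.trans_le (by gcongr; exact min_le_left _ _)
  have hfG : radialEnergy p n f < l * radialMass p n f + l * G / sphereArea N :=
    hfE.trans_le (by gcongr; exact min_le_right _ _)
  have hfE' : radialEnergy p n f ≤ E := by
    refine hfε.le.trans ?_
    rw [hE]
    gcongr
    exact hf.radialMass_le hp0 hr0 hr01 hf1
  have hlow := hbump f hf hf1 hfε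
  have hmodf := hmod f hf hfE'
  obtain ⟨s, ⟨hs1, hs2⟩, hfs⟩ := hlow (ρ - δ)
  obtain ⟨t, ⟨ht1, ht2⟩, hft⟩ := hlow (‖c‖ + s - δ)
  obtain ⟨x₀, hxs, hxt⟩ := exists_norm_sub_eq_norm_eq hN hc0 (s := s) (t := t)
    (by linarith [hρI.1]) (abs_le.2 ⟨by linarith [hρI.1], by linarith [hρI.1]⟩) (by linarith)
  have hnear : ∀ a b, f a ≤ 1 - η → |b - a| < κ → f b ≤ θ := fun a b ha hab => by
    have := (abs_le.1 (hmodf a b hab)).2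
    linarith
  have hfar : ∀ a, f a ≤ 1 - η → κ ≤ |ρ - a| := fun a ha => by
    by_contra! h
    have := hnear a ρ ha h
    linarith
  have hBall : ∀ x ∈ ball x₀ κ, ‖x - c‖ ≤ ρ ∧ ρ ≤ ‖x‖ ∧ f ‖x - c‖ ≤ θ ∧ f ‖x‖ ≤ θ := by
    intro x hx
    rw [mem_ball_iff_norm] at hx
    have h1 : |‖x - c‖ - s| < κ := by
      rw [← hxs]
      refine (abs_norm_sub_norm_le _ _).trans_lt ?_
      rwa [sub_sub_sub_cancel_right]
    have h2 : |‖x‖ - t| < κ := by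
      rw [← hxt]
      exact (abs_norm_sub_norm_le _ _).trans_lt hx
    have h3 := hfar s hfs
    have h4 := hfar t hft
    rw [abs_of_nonneg (by linarith)] at h3
    rw [abs_of_nonpos (by linarith)] at h4
    exact ⟨by linarith [(abs_lt.1 h1).2], by linarith [(abs_lt.1 h2).1],
      hnear s _ hfs h1, hnear t _ hft h2⟩
  have hkey := pLambda1_mul_le_of_isProfile hN hp hr0 hf hf1 hρ hBall
  rw [measureReal_def, Measure.addHaar_ball_center, ← measureReal_def, ← hV, ← hG, ← hn] at hkey
  have hpos : 0 < sphereArea N * radialMass p n f + G := by positivity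
  refine lt_of_mul_lt_mul_right (hkey.trans_lt ?_) hpos.le
  calc sphereArea N * radialEnergy p n f
      < sphereArea N * (l * radialMass p n f + l * G / sphereArea N) := by gcongr
    _ = l * (sphereArea N * radialMass p n f + G) := by field_simp

end
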